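/- arXiv:1801.09981 — 7 statements merged into one kernel-verified Lean document; each statement's English description precedes it below -/
import Mathlib

section
/- For every integer l ≥ 3 and every simple graph G on n vertices containing no cycle of length at least l, the number of edges of G is at most (l-1)(n-1)/2. -/
open Finset in
lemma eg_pred_card {V : Type*} [DecidableEq V] (C : List V) (hC : C.Nodup) (N T : Finset V)
    (h : ∀ w ∈ N, ∃ a A E, C = A ++ a :: w :: E ∧ a ∈ T) : #N ≤ #T := by
  choose! f A E hf using h
  apply Finset.card_le_card_of_injOn f
  · intro w hw
    exact (hf w hw).2
  · intro w hw w' hw' hww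
    have h1 := (hf w hw).1
    have h2 := (hf w' hw').1
    have a1 : C[(A w).length]? = some (f w) := by rw [h1]; simp
    have a2 : C[(A w').length]? = some (f w) := by rw [h2, hww]; simp
    have b1 : C[(A w).length + 1]? = some w := by rw [h1]; simp
    have b2 : C[(A w').length + 1]? = some w' := by rw [h2]; simp
    have hl : (A w).length < C.length := by rw [h1]; simp
    have e := (List.getElem?_inj hl hC).1 (a1.trans a2.symm)
    rw [e] at b1
    rw [b1] at b2
    simpa using b2

lemma eg_rot {V : Type*} (G : SimpleGraph V) (A E : List V) (y a w : V)
    (hA : (A ++ [a]).head? = some y)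
    (h : (A ++ a :: w :: E).IsChain G.Adj) (hyw : G.Adj y w) :
    ((a :: A.reverse) ++ w :: E).IsChain G.Adj := by
  have h' : ((A ++ [a]) ++ (w :: E)).IsChain G.Adj := by simpa using h
  have e : a :: A.reverse = (A ++ [a]).reverse := by simp
  rw [e, List.isChain_append]
  rw [List.isChain_append] at h'
  refine ⟨?_, h'.2.1, ?_⟩
  · rw [List.isChain_reverse]
    exact h'.1.imp (fun _ _ h => h.symm)
  · intro x hx z hz
    rw [List.getLast?_reverse, hA] at hx
    simp at hx hz
    subst hx hz
    exact hyw

lemma eg_longest {V : Type*} [Fintype V] (G : SimpleGraph V) :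
    ∃ L : List V, L.Nodup ∧ L.IsChain G.Adj ∧
      ∀ L' : List V, L'.Nodup → L'.IsChain G.Adj → L'.length ≤ L.length := by
  classical
  let P : ℕ → Prop := fun m => ∃ L : List V, L.Nodup ∧ L.IsChain G.Adj ∧ L.length = m
  have h0 : P 0 := ⟨[], by simp, by simp, rfl⟩
  obtain ⟨L, h1, h2, h3⟩ := Nat.findGreatest_spec (P := P) (Nat.zero_le (Fintype.card V)) h0
  refine ⟨L, h1, h2, fun L' a b => ?_⟩
  rw [h3]
  exact Nat.le_findGreatest a.length_le_card ⟨L', a, b, rfl⟩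

open Finset in
lemma eg_key {V : Type*} [Fintype V] [DecidableEq V] (G : SimpleGraph V) [DecidableRel G.Adj]
    (k : ℕ) (hk : 2 ≤ k)
    (H : ∀ (y : V) (B : List V) (w : V), (y :: B ++ [w]).Nodup → (y :: B ++ [w]).IsChain G.Adj →
      k < (y :: B ++ [w]).length → ¬ G.Adj y w)
    (hE : ∃ a b, G.Adj a b) :
    ∃ (T Z : Finset V) (z : V), T.Nonempty ∧ T ⊆ Z ∧ #Z ≤ k ∧ z ∉ T ∧ (∃ x, G.Adj z x) ∧
      (∀ y ∈ T, ∃ x, G.Adj y x) ∧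
      (∀ y ∈ T, ∀ w, G.Adj y w → w ∈ Z) ∧ (∀ y ∈ T, #(univ.filter (G.Adj y)) ≤ #T) := by
  have hdec : ∀ P : V → Prop, ∃ T : Finset V, ∀ y, y ∈ T ↔ P y := by
    classical
    exact fun P => ⟨univ.filter P, by simp⟩
  obtain ⟨L, hnd, hch, hmax⟩ := eg_longest G
  obtain ⟨a, b, hab⟩ := hE
  have hL2 : 2 ≤ L.length := by
    have := hmax [a, b] (by simpa using hab.ne) (by simpa using hab)
    simpa using this
  obtain ⟨M, z, D, hLe, hM, hMk, hD⟩ : ∃ M z D, L = M ++ z :: D ∧ M ≠ [] ∧ M.length + 1 ≤ k ∧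
      (D = [] ∨ M.length + 1 = k) := by
    set r := min k L.length - 1 with hr
    have hrl : r < L.length := by omega
    refine ⟨L.take r, L[r], L.drop (r+1), ?_, ?_, ?_, ?_⟩
    · simp
    · intro h
      have := congrArg List.length h
      rw [List.length_take, List.length_nil] at this
      omega
    · simp; omega
    · simp; omega
  subst hLe
  obtain ⟨T, hT⟩ := hdec fun y => ∃ B, (y :: B).Perm M ∧ (y :: B ++ z :: D).IsChain G.Adj
  have hnb : ∀ y B, (y :: B).Perm M → (y :: B ++ z :: D).IsChain G.Adj → ∀ w, G.Adj y w →
      w ∈ B ++ [z] := by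
    intro y B hp hc w hyw
    have hnd' : (y :: B ++ z :: D).Nodup := (hp.append_right (z :: D)).nodup_iff.2 hnd
    have hlen : (y :: B).length = M.length := hp.length_eq
    have hmem : w ∈ y :: B ++ z :: D := by
      by_contra hw
      have := hmax (w :: (y :: B ++ z :: D)) (List.nodup_cons.2 ⟨hw, hnd'⟩)
        (by
          rw [List.cons_append, List.isChain_cons_cons]
          exact ⟨hyw.symm, hc⟩)
      simp at this hlen
      omega
    by_contra hw
    have hwD : w ∈ D := by
      have := hyw.ne
      simp at hmem hw
      grind
    obtain ⟨D1, D2, rfl⟩ := List.append_of_mem hwD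
    have e : y :: B ++ z :: (D1 ++ w :: D2) = (y :: (B ++ z :: D1) ++ [w]) ++ D2 := by simp
    rw [e] at hc hnd'
    refine H y (B ++ z :: D1) w hnd'.of_append_left ?_ ?_ hyw
    · exact (List.isChain_append.1 hc).1
    · simp at hlen hD ⊢
      omega
  have hzM : z ∉ M := by
    intro h
    exact (List.nodup_append.1 hnd).2.2 z h z (by simp) rfl
  have hzT : z ∉ T := by
    rw [hT]
    rintro ⟨B, hp, -⟩
    exact hzM (hp.mem_iff.1 (by simp))
  refine ⟨T, (M ++ [z]).toFinset, z, ?_, ?_, ?_, hzT, ?_, ?_, ?_, ?_⟩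
  · obtain ⟨y, B, rfl⟩ := List.exists_cons_of_ne_nil hM
    exact ⟨y, (hT y).2 ⟨B, List.Perm.refl _, hch⟩⟩
  · intro y hy
    obtain ⟨B, hp, -⟩ := (hT y).1 hy
    have : y ∈ M := hp.mem_iff.1 (by simp)
    simp [this]
  · refine (List.toFinset_card_le _).trans ?_
    simpa using hMk
  · obtain ⟨M', x, rfl⟩ := (List.eq_nil_or_concat' M).resolve_left hM
    rw [List.append_assoc, List.singleton_append, List.isChain_append_cons_cons] at hch
    exact ⟨x, hch.2.1.symm⟩
  · intro y hy
    obtain ⟨B, hp, hc⟩ := (hT y).1 hy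
    rcases B with _ | ⟨x, B⟩
    · exact ⟨z, by simpa using hc.rel⟩
    · exact ⟨x, by simpa using hc.rel⟩
  · intro y hy w hw
    obtain ⟨B, hp, hc⟩ := (hT y).1 hy
    have := hnb y B hp hc w hw
    have h2 := hp.mem_iff (a := w)
    simp at this h2 ⊢
    tauto
  · intro y hy
    obtain ⟨B, hp, hc⟩ := (hT y).1 hy
    have hnd' : (y :: B ++ z :: D).Nodup := (hp.append_right (z :: D)).nodup_iff.2 hnd
    refine eg_pred_card (y :: B ++ z :: D) hnd' _ _ ?_
    intro w hw
    simp at hw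
    have hwB := hnb y B hp hc w hw
    obtain ⟨B1, B2, hB⟩ := List.append_of_mem hwB
    -- y :: B ++ [z] = (y :: B1) ++ w :: B2
    obtain ⟨A, a, hA⟩ := (List.eq_nil_or_concat' (y :: B1)).resolve_left (by simp)
    have e1 : y :: B ++ z :: D = A ++ a :: w :: (B2 ++ D) := by
      have : y :: B ++ z :: D = y :: (B ++ [z]) ++ D := by simp
      rw [this, hB]
      have : y :: (B1 ++ w :: B2) ++ D = (y :: B1) ++ w :: (B2 ++ D) := by simp
      rw [this, hA]; simp
    refine ⟨a, A, B2 ++ D, e1, (hT a).2 ?_⟩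
    rw [e1] at hc
    have hc' := eg_rot G A (B2 ++ D) y a w (by rw [← hA]; rfl) hc hw
    -- B1 ++ w :: B2 = B ++ [z]
    obtain ⟨E, hE⟩ : ∃ E, w :: B2 = E ++ [z] := by
      obtain ⟨E, x, hE⟩ := (List.eq_nil_or_concat' (w :: B2)).resolve_left (by simp)
      refine ⟨E, ?_⟩
      rw [hE, ← List.append_assoc] at hB
      have := (List.append_inj' hB rfl).2
      simp at this
      rw [hE, this]
    have hBe : B = B1 ++ E := by
      rw [hE, ← List.append_assoc] at hB
      exact (List.append_inj' hB rfl).1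
    refine ⟨A.reverse ++ E, ?_, ?_⟩
    · refine List.Perm.trans ?_ hp
      have : y :: B = A ++ [a] ++ E := by rw [← hA, hBe]; simp
      rw [this]
      have : a :: (A.reverse ++ E) = (A ++ [a]).reverse ++ E := by simp
      rw [this]
      exact (List.reverse_perm _).append_right E
    · have : a :: (A.reverse ++ E) ++ z :: D = (a :: A.reverse) ++ w :: (B2 ++ D) := by
        have : w :: (B2 ++ D) = (w :: B2) ++ D := by simp
        rw [this, hE]; simp
      rw [this]; exact hc'

open Finset in
lemma eg_main {V : Type*} [Fintype V] [DecidableEq V] (k : ℕ) (hk : 2 ≤ k) (m : ℕ) :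
    ∀ (S : Finset V) (G : SimpleGraph V) [DecidableRel G.Adj], #S = m →
    (∀ (y : V) (B : List V) (w : V), (y :: B ++ [w]).Nodup → (y :: B ++ [w]).IsChain G.Adj →
      k < (y :: B ++ [w]).length → ¬ G.Adj y w) →
    (∀ a b, G.Adj a b → a ∈ S) →
    #(univ.filter fun p : V × V => G.Adj p.1 p.2) ≤ k * (m - 1) := by
  induction m using Nat.strong_induction_on with
  | _ m ih =>
  intro S G _ hS H hGS
  by_cases hE : ∃ a b, G.Adj a b
  swap
  · push Not at hE
    simp [hE]
  obtain ⟨T, Z, z, hTn, hTZ, hZ, hzT, ⟨x, hzx⟩, hTx, hTN, hTd⟩ := eg_key G k hk H hE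
  let G' : SimpleGraph V :=
    { Adj := fun a b => G.Adj a b ∧ a ∉ T ∧ b ∉ T
      symm := ⟨fun a b h => ⟨h.1.symm, h.2.2, h.2.1⟩⟩
      loopless := ⟨fun a h => G.loopless.irrefl a h.1⟩ }
  have : DecidableRel G'.Adj := fun a b => inferInstanceAs (Decidable (_ ∧ _ ∧ _))
  have hTS : T ⊆ S := fun y hy => by
    obtain ⟨x, hx⟩ := hTx y hy
    exact hGS _ _ hx
  have hcs : #(S \ T) = m - #T := by rw [card_sdiff_of_subset hTS, hS]
  have hpos := hTn.card_pos
  have hlt : #T < m := by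
    rw [← hS]
    exact card_lt_card ⟨hTS, fun h => hzT (h (hGS _ _ hzx))⟩
  have h1 := ih (m - #T) (by omega) (S \ T) G' hcs
    (fun y B w a b c d => H y B w a (b.imp fun _ _ h => h.1) c d.1)
    (fun a b h => mem_sdiff.2 ⟨hGS _ _ h.1, h.2.1⟩)
  have hsub : (univ.filter fun p : V × V => G.Adj p.1 p.2) ⊆
      (univ.filter fun p : V × V => G'.Adj p.1 p.2) ∪
      (T.biUnion fun y => (univ.filter (G.Adj y)).image (fun w => (y, w)) ∪
        (Z \ T).image (fun w => (w, y))) := by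
    rintro ⟨a, b⟩ h
    simp only [mem_filter, mem_univ, true_and] at h
    simp only [mem_union, mem_filter, mem_univ, true_and, mem_biUnion, mem_image, Prod.mk.injEq,
      mem_sdiff]
    by_cases ha : a ∈ T
    · exact Or.inr ⟨a, ha, Or.inl ⟨b, h, rfl, rfl⟩⟩
    by_cases hb : b ∈ T
    · exact Or.inr ⟨b, hb, Or.inr ⟨a, ⟨hTN b hb a h.symm, ha⟩, rfl, rfl⟩⟩
    · exact Or.inl ⟨h, ha, hb⟩
  have h2 : #(T.biUnion fun y => (univ.filter (G.Adj y)).image (fun w => (y, w)) ∪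
        (Z \ T).image (fun w => (w, y))) ≤ #T * k := by
    refine card_biUnion_le_card_mul _ _ _ fun y hy => ?_
    refine (card_union_le _ _).trans ?_
    have c1 := card_image_le (s := univ.filter (G.Adj y)) (f := fun w => (y, w))
    have c2 := card_image_le (s := Z \ T) (f := fun w => (w, y))
    have c3 := hTd y hy
    have c4 := card_sdiff_of_subset hTZ
    have c5 := card_le_card hTZ
    omega
  have h3 := (card_le_card hsub).trans (card_union_le _ _)
  have h4 : k * (m - 1) = k * (m - #T - 1) + #T * k := by
    have : m - 1 = (m - #T - 1) + #T := by omega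
    rw [this]; ring
  omega

/-- Erdős–Gallai theorem for cycles: a graph on `n` vertices with no cycle of
length at least `l` (where `l ≥ 3`) has at most `(l-1)(n-1)/2` edges. -/
theorem erdos_gallai_cycles {V : Type*} [Fintype V] (G : SimpleGraph V) (l : ℕ) (hl : 3 ≤ l)
    (hG : ∀ (v : V) (c : G.Walk v v), c.IsCycle → c.length < l) :
    (Nat.card G.edgeSet : ℚ) ≤ ((l - 1 : ℕ) : ℚ) * ((Fintype.card V - 1 : ℕ) : ℚ) / 2 := by
  classical
  have h := eg_main (l - 1) (by omega) (Fintype.card V) Finset.univ G rfl ?_ (by simp)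
  · have h2 := G.two_mul_card_edgeFinset
    have h3 : Nat.card G.edgeSet = G.edgeFinset.card := by
      rw [Nat.card_eq_fintype_card, SimpleGraph.edgeFinset_card]
    rw [h3, le_div_iff₀ (by norm_num)]
    have h4 : G.edgeFinset.card * 2 ≤ (l - 1) * (Fintype.card V - 1) := by
      rw [mul_comm, h2]; exact h
    exact_mod_cast h4
  · intro y B w hnd hch hlen hyw
    have hne : y :: B ++ [w] ≠ [] := by simp
    obtain ⟨p, hp⟩ : ∃ p : G.Walk y w, p.support = y :: B ++ [w] := by
      have q := SimpleGraph.Walk.support_ofSupport hne hch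
      have e1 : (y :: B ++ [w]).head hne = y := by simp
      have e2 : (y :: B ++ [w]).getLast hne = w := by simp
      exact ⟨(SimpleGraph.Walk.ofSupport _ hne hch).copy e1 e2, (SimpleGraph.Walk.support_copy _ e1 e2).trans q⟩
    have hpath : p.IsPath := by rw [SimpleGraph.Walk.isPath_def, hp]; exact hnd
    have hplen : p.length + 1 = (y :: B ++ [w]).length := by
      rw [← hp, SimpleGraph.Walk.length_support]
    have hc : (SimpleGraph.Walk.cons hyw.symm p).IsCycle := by
      rw [SimpleGraph.Walk.cons_isCycle_iff]
      refine ⟨hpath, fun hh => ?_⟩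
      have : p.support[0] = p.support[p.length - 1] := by
        simp [← List.head_eq_getElem_zero, hpath.eq_penultimate_of_mem_edges hh]
      have := p.isPath_iff_injective_get_support.mp hpath this
      simp at this
      omega
    have := hG _ _ hc
    simp only [SimpleGraph.Walk.length_cons] at this
    omega
end

section
/- For every integer l ≥ 2 and every simple graph G on n vertices containing no path with l vertices, the number of edges of G is at most (l-2)n/2. -/
theorem eg_walk {V : Type*} (G : SimpleGraph V) : ∀ (p : List V) (a : V),
    List.IsChain G.Adj (a :: p) → ∃ (v : V) (w : G.Walk a v), w.support = a :: p
  | [], a, _ => ⟨a, SimpleGraph.Walk.nil, rfl⟩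
  | b :: p, a, h => by
    rw [List.isChain_cons_cons] at h
    obtain ⟨v, w, hw⟩ := eg_walk G p b h.2
    exact ⟨v, SimpleGraph.Walk.cons h.1 w, by simp [hw]⟩

theorem eg_short {V : Type*} (G : SimpleGraph V) (l : ℕ) (hl : 2 ≤ l)
    (hG : ¬ ∃ (u v : V) (p : G.Walk u v), p.IsPath ∧ p.length + 1 = l)
    (p : List V) (hc : List.IsChain G.Adj p) (hn : p.Nodup) : p.length < l := by
  by_contra hlen
  push Not at hlen
  have hc' : List.IsChain G.Adj (p.take l) := hc.take l
  have hn' : (p.take l).Nodup := hn.sublist (List.take_sublist l p)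
  have hl' : (p.take l).length = l := by simp [hlen]
  generalize p.take l = q at *
  cases q with
  | nil => simp at hl'; omega
  | cons a q =>
    obtain ⟨v, w, hw⟩ := eg_walk G q a hc'
    refine hG ⟨a, v, w, ?_, ?_⟩
    · rw [SimpleGraph.Walk.isPath_def, hw]; exact hn'
    · rw [← SimpleGraph.Walk.length_support, hw]; exact hl'

/-- Crossing chords give a way to rotate a path so that any vertex becomes an end. -/
theorem eg_rotate {V : Type*} (G : SimpleGraph V) (A B : List V) (hA : A ≠ []) (hB : B ≠ [])
    (hc : List.IsChain G.Adj (A ++ B))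
    (h1 : G.Adj (A.head hA) (B.head hB)) (h2 : G.Adj (B.getLast hB) (A.getLast hA))
    (w : V) (hw : w ∈ A ++ B) :
    ∃ q : List V, List.IsChain G.Adj (w :: q) ∧ (w :: q).Perm (A ++ B) := by
  have hcA := hc.left_of_append
  have hcB := hc.right_of_append
  have hC : List.IsChain G.Adj (A.reverse ++ B) := by
    rw [List.isChain_append]
    refine ⟨?_, hcB, ?_⟩
    · rw [List.isChain_reverse]
      exact hcA.imp fun a b h => h.symm
    · intro x hx y hy
      rw [List.getLast?_reverse, List.head?_eq_some_head hA] at hx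
      rw [List.head?_eq_some_head hB] at hy
      simp at hx hy
      subst hx hy
      exact h1
  have hperm : (A.reverse ++ B).Perm (A ++ B) := (List.reverse_perm A).append_right B
  have hclose : ∀ x ∈ (A.reverse ++ B).getLast?, ∀ y ∈ (A.reverse ++ B).head?, G.Adj x y := by
    intro x hx y hy
    rw [List.getLast?_append_of_ne_nil _ hB, List.getLast?_eq_some_getLast hB] at hx
    rw [List.head?_append_of_ne_nil _ (by simpa using hA), List.head?_reverse,
      List.getLast?_eq_some_getLast hA] at hy
    simp at hx hy
    subst hx hy
    exact h2
  have hw' : w ∈ A.reverse ++ B := hperm.mem_iff.2 hw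
  generalize A.reverse ++ B = C at *
  obtain ⟨C1, C2, rfl⟩ := List.append_of_mem hw'
  refine ⟨C2 ++ C1, ?_, ?_⟩
  · rw [← List.cons_append, List.isChain_append]
    refine ⟨hC.right_of_append, hC.left_of_append, ?_⟩
    intro x hx y hy
    apply hclose
    · rw [List.getLast?_append_of_ne_nil _ (by simp)]; exact hx
    · cases C1 with
      | nil => simp at hy
      | cons c C1 => simpa using hy
  · refine List.Perm.trans ?_ hperm
    rw [← List.cons_append]
    exact List.perm_append_comm

open Classical in
theorem eg_main_s1 {V : Type*} (G : SimpleGraph V) (l : ℕ) (hl : 2 ≤ l)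
    (hG : ∀ p : List V, List.IsChain G.Adj p → p.Nodup → p.length < l) :
    ∀ (n : ℕ) (S : Finset V), S.card = n →
      ∑ x ∈ S, (∑ y ∈ S, if G.Adj x y then 1 else 0) ≤ (l - 2) * S.card := by
  intro n
  induction n using Nat.strong_induction_on with
  | _ n ih =>
  intro S hS
  rcases S.eq_empty_or_nonempty with rfl | ⟨s, hs⟩
  · simp
  -- longest path
  let Q : List V → Prop := fun p => List.IsChain G.Adj p ∧ p.Nodup ∧ ∀ x ∈ p, x ∈ S
  obtain ⟨p, hp, hne, hmax⟩ : ∃ p, Q p ∧ p ≠ [] ∧ ∀ q, Q q → q.length ≤ p.length := by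
    let P : ℕ → Prop := fun k => ∃ q, Q q ∧ q.length = k
    have hP1 : P 1 := ⟨[s], ⟨by simp, by simp, by simpa using hs⟩, rfl⟩
    have hgr := Nat.findGreatest_spec (P := P) (n := l) (by omega) hP1
    obtain ⟨p, hp, hpl⟩ := hgr
    have hle : ∀ q, Q q → q.length ≤ p.length := fun q hq => by
      rw [hpl]
      exact Nat.le_findGreatest (hG q hq.1 hq.2.1).le ⟨q, hq, rfl⟩
    refine ⟨p, hp, ?_, hle⟩
    rintro rfl
    have := hle [s] ⟨by simp, by simp, by simpa using hs⟩
    simp at this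
  obtain ⟨hpc, hpn, hpS⟩ := hp
  have hpl := hG p hpc hpn
  have hpos : 0 < p.length := List.length_pos_iff.2 hne
  -- low degree vertex
  by_cases hlow : ∃ v ∈ S, 2 * (∑ y ∈ S, if G.Adj v y then 1 else 0) ≤ l - 2
  · obtain ⟨v, hv, hd⟩ := hlow
    have hcard : (S.erase v).card + 1 = S.card := Finset.card_erase_add_one hv
    have := ih _ (by omega) (S.erase v) rfl
    have e1 : ∀ f : V → ℕ, ∑ x ∈ S, f x = f v + ∑ x ∈ S.erase v, f x :=
      fun f => (Finset.add_sum_erase S f hv).symm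
    rw [e1]
    have e2 : ∑ x ∈ S.erase v, (∑ y ∈ S, if G.Adj x y then 1 else 0)
        = (∑ y ∈ S.erase v, if G.Adj v y then 1 else 0)
          + ∑ x ∈ S.erase v, (∑ y ∈ S.erase v, if G.Adj x y then 1 else 0) := by
      rw [← Finset.sum_add_distrib]
      refine Finset.sum_congr rfl fun x _ => ?_
      rw [e1]
      simp only [G.adj_comm x v]
    have e3 := e1 (fun y => if G.Adj v y then 1 else 0)
    simp only [SimpleGraph.irrefl, if_false, zero_add] at e3
    rw [e2, ← e3, ← hcard, Nat.mul_add]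
    omega
  push Not at hlow
  have hdeg : ∀ v, (∑ y ∈ S, if G.Adj v y then 1 else 0) = (S.filter (G.Adj v)).card := fun v => by
    simp
  -- any extension at the front stays in the path
  have hext : ∀ (w : V) (q : List V), List.IsChain G.Adj (w :: q) → (w :: q).Perm p →
      ∀ u ∈ S, G.Adj w u → u ∈ p := by
    intro w q hq hqp u hu hwu
    by_contra hup
    have := hmax (u :: w :: q) ⟨?_, ?_, ?_⟩
    · have := hqp.length_eq
      simp at *
      omega
    · rw [List.isChain_cons_cons]; exact ⟨hwu.symm, hq⟩
    · rw [List.nodup_cons, hqp.mem_iff, hqp.nodup_iff]; exact ⟨hup, hpn⟩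
    · intro x hx
      rw [List.mem_cons, hqp.mem_iff] at hx
      rcases hx with rfl | hx
      · exact hu
      · exact hpS x hx
  have hfirst : ∀ u ∈ S, G.Adj (p.head hne) u → u ∈ p := by
    apply hext _ p.tail
    · rw [List.cons_head_tail]; exact hpc
    · rw [List.cons_head_tail]
  have hlast : ∀ u ∈ S, G.Adj (p.getLast hne) u → u ∈ p := by
    have hr : p.reverse ≠ [] := by simpa using hne
    have : p.getLast hne = p.reverse.head hr := by simp
    rw [this]
    apply hext _ p.reverse.tail
    · rw [List.cons_head_tail, List.isChain_reverse]
      exact hpc.imp fun a b h => h.symm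
    · rw [List.cons_head_tail]; exact List.reverse_perm p
  -- crossing chords
  obtain ⟨i, hi, hi1, hi2⟩ : ∃ i, ∃ h : i + 1 < p.length, G.Adj (p.head hne) p[i+1] ∧
      G.Adj (p.getLast hne) p[i] := by
    let m := p.length - 1
    let I := (Finset.range m).filter fun i => ∃ h : i + 1 < p.length, G.Adj (p.head hne) p[i+1]
    let J := (Finset.range m).filter fun i => ∃ h : i < p.length, G.Adj (p.getLast hne) p[i]
    have hI : (S.filter (G.Adj (p.head hne))).card ≤ I.card := by
      refine Finset.card_le_card_of_surjOn (fun i => p.getD (i+1) s) ?_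
      intro u hu
      simp only [Finset.coe_filter, Set.mem_setOf_eq] at hu
      obtain ⟨j, hj, rfl⟩ := List.getElem_of_mem (hfirst u hu.1 hu.2)
      cases j with
      | zero => 
        exfalso
        rw [List.head_eq_getElem] at hu
        exact G.irrefl hu.2
      | succ j =>
        refine ⟨j, ?_, ?_⟩
        · simp only [I, m, Finset.coe_filter, Set.mem_setOf_eq, Finset.mem_range]
          exact ⟨by omega, hj, hu.2⟩
        · simp [hj]
    have hJ : (S.filter (G.Adj (p.getLast hne))).card ≤ J.card := by
      refine Finset.card_le_card_of_surjOn (fun i => p.getD i s) ?_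
      intro u hu
      simp only [Finset.coe_filter, Set.mem_setOf_eq] at hu
      obtain ⟨j, hj, rfl⟩ := List.getElem_of_mem (hlast u hu.1 hu.2)
      have hjm : j ≠ p.length - 1 := by
        rintro rfl
        rw [List.getLast_eq_getElem] at hu
        exact G.irrefl hu.2
      refine ⟨j, ?_, ?_⟩
      · simp only [J, m, Finset.coe_filter, Set.mem_setOf_eq, Finset.mem_range]
        exact ⟨by omega, hj, hu.2⟩
      · simp [hj]
    have h1 := hlow _ (hpS _ (List.head_mem hne))
    have h2 := hlow _ (hpS _ (List.getLast_mem hne))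
    rw [hdeg] at h1 h2
    have hU : (I ∪ J).card ≤ m := by
      have : I ∪ J ⊆ Finset.range m :=
        Finset.union_subset (Finset.filter_subset _ _) (Finset.filter_subset _ _)
      simpa using Finset.card_le_card this
    have hUI := Finset.card_union_add_card_inter I J
    have : 0 < (I ∩ J).card := by omega
    obtain ⟨i, hi⟩ := Finset.card_pos.1 this
    simp only [I, J, Finset.mem_inter, Finset.mem_filter] at hi
    obtain ⟨⟨_, h, h'⟩, _, _, h''⟩ := hi
    exact ⟨i, h, h', h''⟩
  have hclosed : ∀ w ∈ p, ∀ u ∈ S, G.Adj w u → u ∈ p := by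
    intro w hw
    have hA : p.take (i+1) ≠ [] := by
      rw [← List.length_pos_iff, List.length_take]; omega
    have hB : p.drop (i+1) ≠ [] := by
      rw [← List.length_pos_iff, List.length_drop]; omega
    obtain ⟨q, hq, hqp⟩ := eg_rotate G (p.take (i+1)) (p.drop (i+1)) hA hB
      (by rw [List.take_append_drop]; exact hpc)
      (by simpa [List.head_drop, List.head_take] using hi1)
      (by
        have : (p.take (i+1)).getLast hA = p[i] := by
          rw [List.getLast_eq_getElem, List.getElem_take]
          congr 1
          rw [List.length_take]; omega
        rw [this, List.getLast_drop]; exact hi2) w (by rw [List.take_append_drop]; exact hw)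
    rw [List.take_append_drop] at hqp
    exact hext w q hq hqp
  -- remove the whole path
  have hTS : p.toFinset ⊆ S := fun x hx => hpS x (List.mem_toFinset.1 hx)
  have hTc : p.toFinset.card = p.length := List.toFinset_card_of_nodup hpn
  have hcard := Finset.card_sdiff_add_card_eq_card hTS
  have := ih _ (by omega) (S \ p.toFinset) rfl
  rw [← Finset.sum_sdiff hTS, ← hcard, Nat.mul_add]
  refine Nat.add_le_add ?_ ?_
  · refine le_trans (le_of_eq ?_) this
    refine Finset.sum_congr rfl fun x hx => ?_
    rw [← Finset.sum_sdiff hTS]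
    rw [add_eq_left]
    refine Finset.sum_eq_zero fun y hy => ?_
    rw [if_neg]
    intro hxy
    rw [Finset.mem_sdiff, List.mem_toFinset] at hx
    exact hx.2 (hclosed y (List.mem_toFinset.1 hy) x hx.1 hxy.symm)
  · rw [mul_comm, ← smul_eq_mul]
    refine Finset.sum_le_card_nsmul _ _ _ fun x hx => ?_
    rw [hdeg]
    have : S.filter (G.Adj x) ⊆ p.toFinset.erase x := by
      intro y hy
      rw [Finset.mem_filter] at hy
      rw [Finset.mem_erase, List.mem_toFinset]
      exact ⟨hy.2.ne', hclosed x (List.mem_toFinset.1 hx) y hy.1 hy.2⟩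
    have h3 := Finset.card_le_card this
    rw [Finset.card_erase_of_mem hx] at h3
    omega

/-- Erdős–Gallai theorem for paths: a graph on `n` vertices with no path on
`l` vertices (where `l ≥ 2`) has at most `(l-2)n/2` edges. -/
theorem erdos_gallai_paths {V : Type*} [Fintype V] (G : SimpleGraph V) (l : ℕ) (hl : 2 ≤ l)
    (hG : ¬ ∃ (u v : V) (p : G.Walk u v), p.IsPath ∧ p.length + 1 = l) :
    (Nat.card G.edgeSet : ℚ) ≤ ((l - 2 : ℕ) : ℚ) * (Fintype.card V : ℚ) / 2 := by
  classical
  have h := eg_main_s1 G l hl (eg_short G l hl hG) _ Finset.univ rfl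
  have h2 := G.sum_degrees_eq_twice_card_edges
  have h3 : Nat.card G.edgeSet = G.edgeFinset.card := by
    rw [Nat.card_eq_fintype_card, SimpleGraph.edgeFinset_card]
  have h4 : ∑ x : V, (∑ y : V, if G.Adj x y then 1 else 0) = ∑ x : V, G.degree x := by
    refine Finset.sum_congr rfl fun x _ => ?_
    rw [← SimpleGraph.card_neighborFinset_eq_degree, SimpleGraph.neighborFinset_eq_filter]
    simp
  have h5 : 2 * Nat.card G.edgeSet ≤ (l - 2) * Fintype.card V := by
    rw [h3, ← h2, ← h4]
    rw [Finset.card_univ] at h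
    convert h using 1
  have h6 : ((2 * Nat.card G.edgeSet : ℕ) : ℚ) ≤ (((l - 2) * Fintype.card V : ℕ) : ℚ) := by
    exact_mod_cast h5
  rw [Nat.cast_mul, Nat.cast_mul] at h6
  push_cast at h6
  linarith
end

section
/- Let G be a finite simple graph and let k be an integer with 2 ≤ k ≤ ω(G), so that N_k(G) > 0. Then G contains a cycle of length t for every integer t with 3 ≤ t ≤ ⌈(k+1)·N_{k+1}(G)/N_k(G)⌉ + k. -/
/-- `cliqueCount G j` is `N_j(G)`, the number of `j`-vertex cliques (copies of `K_j`) in `G`. -/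
noncomputable def cliqueCount {V : Type*} (G : SimpleGraph V) (j : ℕ) : ℕ :=
  Set.ncard {s : Finset V | G.IsNClique j s}

open Finset in
theorem aux_crossover {V : Type*} (G : SimpleGraph V) (l : List V) (hl : l ≠ []) (i : ℕ)
    (hi : i + 1 < l.length) (hc : l.IsChain G.Adj) (hn : l.Nodup)
    (h1 : G.Adj (l[0]'(by omega)) l[i+1])
    (h2 : G.Adj (l[l.length - 1]'(by omega)) (l[i]'(by omega))) :
    ∃ c : List V, c.Perm l ∧ c.IsChain G.Adj ∧
      ∀ x ∈ c.getLast?, ∀ y ∈ c.head?, G.Adj x y := by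
  refine ⟨l.take (i+1) ++ (l.drop (i+1)).reverse, ?_, ?_, ?_⟩
  · conv_rhs => rw [← List.take_append_drop (i+1) l]
    exact (List.reverse_perm _).append_left _
  · rw [List.isChain_append]
    refine ⟨hc.take _, ?_, ?_⟩
    · rw [List.isChain_reverse]
      exact (hc.drop _).imp (fun a b h => h.symm)
    · intro x hx y hy
      rw [List.head?_reverse] at hy
      simp only [List.getLast?_drop, List.getLast?_take] at hx hy
      rw [if_neg (by omega)] at hy
      rw [List.getLast?_eq_getElem?, List.getElem?_eq_getElem (by omega)] at hy
      simp at hx hy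
      rw [List.getElem?_eq_getElem (by omega)] at hx
      simp at hx
      rcases hx with hx | hx
      · subst hx hy
        exact h2.symm
      · omega
  · intro x hx y hy
    rw [List.getLast?_append, List.getLast?_reverse, List.head?_drop,
      List.getElem?_eq_getElem (by omega)] at hx
    rw [List.head?_append, List.head?_take, if_neg (by omega), List.head?_eq_getElem?,
      List.getElem?_eq_getElem (by omega)] at hy
    simp at hx hy
    subst hx hy
    exact h1.symm

theorem aux_extend {V : Type*} (G : SimpleGraph V) (c : List V) (hc : c.IsChain G.Adj)
    (hn : c.Nodup) (hcl : ∀ x ∈ c.getLast?, ∀ y ∈ c.head?, G.Adj x y) (u w : V) (hu : u ∉ c)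
    (hw : w ∈ c) (h : G.Adj u w) :
    ∃ d : List V, d.Perm (u :: c) ∧ d.IsChain G.Adj := by
  obtain ⟨a, b, rfl⟩ := List.append_of_mem hw
  refine ⟨u :: ((w :: b) ++ a), (List.perm_append_comm).cons _, ?_⟩
  rw [List.isChain_append] at hc
  rw [List.isChain_cons, List.isChain_append]
  refine ⟨by simpa using h, hc.2.1, hc.1, ?_⟩
  intro x hx y hy
  apply hcl x _ y
  · rw [List.head?_append]
    simp at hy
    simp [hy]
  · rw [List.getLast?_append]
    simp at hx
    simp [hx]

open Finset Classical in
theorem aux_EG {V : Type*} (G : SimpleGraph V) (m : ℕ) : ∀ (n : ℕ) (S : Finset V), #S = n →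
    (∀ l : List V, l.Nodup → l.IsChain G.Adj → (∀ x ∈ l, x ∈ S) → l.length ≤ m + 1) →
    ∑ v ∈ S, #{u ∈ S | G.Adj v u} ≤ m * #S := by
  intro n
  induction n using Nat.strong_induction_on with
  | _ n ih =>
  intro S hS h
  by_cases hne : S = ∅
  · simp [hne]
  by_cases hlow : ∃ v ∈ S, 2 * #{u ∈ S | G.Adj v u} ≤ m
  · obtain ⟨v, hv, hd⟩ := hlow
    have hpos : 0 < #S := card_pos.2 ⟨v, hv⟩
    have hce : #(S.erase v) = #S - 1 := card_erase_of_mem hv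
    have := ih (#(S.erase v)) (by omega) (S.erase v) rfl
      (fun l a b c => h l a b (fun x hx => mem_of_mem_erase (c x hx)))
    have key : ∑ w ∈ S.erase v, #{u ∈ S | G.Adj w u} =
        ∑ w ∈ S.erase v, #{u ∈ S.erase v | G.Adj w u} + #{u ∈ S | G.Adj v u} := by
      have : #{u ∈ S | G.Adj v u} = ∑ w ∈ S.erase v, if G.Adj v w then 1 else 0 := by
        rw [← card_filter]
        congr 1
        ext x
        simp only [mem_filter, mem_erase]
        constructor
        · rintro ⟨a, b⟩; exact ⟨⟨b.ne', a⟩, b⟩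
        · rintro ⟨⟨a, b⟩, c⟩; exact ⟨b, c⟩
      rw [this, ← sum_add_distrib]
      apply sum_congr rfl
      intro w hw
      rw [← insert_erase hv, filter_insert, erase_insert_eq_erase, erase_idem]
      simp only [G.adj_comm w v]
      split_ifs with hh
      · rw [card_insert_of_notMem (by simp)]
      · simp
    rw [← add_sum_erase S _ hv, key]
    obtain ⟨q, hq⟩ : ∃ q, #S = q + 1 := ⟨#S - 1, by omega⟩
    have e : #(S.erase v) = q := by omega
    rw [e] at this
    rw [hq, Nat.mul_succ]
    omega
  push Not at hlow
  -- longest list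
  let P : ℕ → Prop := fun j => ∃ l : List V, l.Nodup ∧ l.IsChain G.Adj ∧ (∀ x ∈ l, x ∈ S) ∧ l.length = j
  obtain ⟨v0, hv0⟩ := nonempty_iff_ne_empty.2 hne
  have hP1 : P 1 := ⟨[v0], by simp, by simp, by simpa using hv0, rfl⟩
  have hb : ∀ j, P j → j ≤ m + 1 := by
    rintro j ⟨l, a, b, c, rfl⟩; exact h l a b c
  have hp := Nat.findGreatest_spec (P := P) (hb 1 hP1) hP1
  have hp1 : 1 ≤ Nat.findGreatest P (m+1) := Nat.le_findGreatest (hb 1 hP1) hP1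
  have hmax : ∀ j, P j → j ≤ Nat.findGreatest P (m+1) := fun j hj => Nat.le_findGreatest (hb j hj) hj
  generalize Nat.findGreatest P (m+1) = p at *
  obtain ⟨l, hn, hc, hlS, hlen⟩ := hp
  have hpm : p ≤ m + 1 := hb p ⟨l, hn, hc, hlS, hlen⟩
  have hl0 : l ≠ [] := by rintro rfl; simp at hlen; omega
  have hx : ∀ u ∈ S, G.Adj (l[0]'(by omega)) u → u ∈ l := by
    intro u hu ha
    by_contra hnu
    have := hmax (p+1) ⟨u :: l, by simp [hn, hnu], by
      rw [List.isChain_cons]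
      refine ⟨?_, hc⟩
      intro y hy
      rw [List.head?_eq_getElem?, List.getElem?_eq_getElem (by omega)] at hy
      simp at hy; subst hy; exact ha.symm, by simpa [hu] using hlS, by simp [hlen]⟩
    omega
  have hy : ∀ u ∈ S, G.Adj (l[l.length-1]'(by omega)) u → u ∈ l := by
    intro u hu ha
    by_contra hnu
    have := hmax (p+1) ⟨l ++ [u], by simpa using (List.nodup_append_comm.1 (by simp [hn, hnu])), by
      rw [List.isChain_append]
      refine ⟨hc, by simp, ?_⟩
      intro y hy z hz
      rw [List.getLast?_eq_getElem?, List.getElem?_eq_getElem (by omega)] at hy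
      simp at hy hz; subst hy hz; exact ha, by
        intro z hz
        simp at hz
        rcases hz with hz | rfl
        · exact hlS z hz
        · exact hu, by simp [hlen]⟩
    omega
  have hA : #{u ∈ S | G.Adj (l[0]'(by omega)) u} ≤
      #{i ∈ range (p-1) | ∃ h : i + 1 < l.length, G.Adj (l[0]'(by omega)) l[i+1]} := by
    refine le_trans (card_le_card (t := image (fun i => if h : i + 1 < l.length then l[i+1] else v0) _) ?_) card_image_le
    intro u hu
    simp only [mem_filter] at hu
    obtain ⟨j, hj, rfl⟩ := List.getElem_of_mem (hx u hu.1 hu.2)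
    have hj0 : j ≠ 0 := by rintro rfl; exact G.loopless.irrefl _ hu.2
    obtain ⟨i, rfl⟩ := Nat.exists_eq_succ_of_ne_zero hj0
    rw [mem_image]
    refine ⟨i, ?_, by simp at hj; simp [hj]⟩
    simp only [mem_filter, mem_range]
    exact ⟨by simp at hj; omega, hj, hu.2⟩
  have hB : #{u ∈ S | G.Adj (l[l.length-1]'(by omega)) u} ≤
      #{i ∈ range (p-1) | ∃ h : i < l.length, G.Adj (l[l.length-1]'(by omega)) l[i]} := by
    refine le_trans (card_le_card (t := image (fun i => if h : i < l.length then l[i] else v0) _) ?_) card_image_le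
    intro u hu
    simp only [mem_filter] at hu
    obtain ⟨j, hj, rfl⟩ := List.getElem_of_mem (hy u hu.1 hu.2)
    have hj0 : j ≠ l.length - 1 := by rintro rfl; exact G.loopless.irrefl _ hu.2
    rw [mem_image]
    refine ⟨j, ?_, by simp [hj]⟩
    simp only [mem_filter, mem_range]
    exact ⟨by omega, hj, hu.2⟩
  have hd1 := hlow _ (hlS (l[0]'(by omega)) (List.getElem_mem _))
  have hd2 := hlow _ (hlS (l[l.length-1]'(by omega)) (List.getElem_mem _))
  obtain ⟨i, hi⟩ : ({i ∈ range (p-1) | ∃ h : i + 1 < l.length, G.Adj (l[0]'(by omega)) l[i+1]} ∩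
      {i ∈ range (p-1) | ∃ h : i < l.length, G.Adj (l[l.length-1]'(by omega)) l[i]}).Nonempty := by
    rw [← card_pos]
    have e1 := card_union_add_card_inter {i ∈ range (p-1) | ∃ h : i + 1 < l.length, G.Adj (l[0]'(by omega)) l[i+1]} {i ∈ range (p-1) | ∃ h : i < l.length, G.Adj (l[l.length-1]'(by omega)) l[i]}
    have e2 := card_le_card (union_subset (filter_subset (fun i => ∃ h : i + 1 < l.length, G.Adj (l[0]'(by omega)) l[i+1]) (range (p-1))) (filter_subset (fun i => ∃ h : i < l.length, G.Adj (l[l.length-1]'(by omega)) l[i]) (range (p-1))))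
    rw [card_range] at e2
    omega
  simp only [mem_inter, mem_filter] at hi
  obtain ⟨⟨_, hi1, h1⟩, _, _, h2⟩ := hi
  obtain ⟨c, hcp, hcc, hcl⟩ := aux_crossover G l hl0 i hi1 hc hn h1 h2
  have hclosed : ∀ u ∈ S, ∀ w ∈ l, G.Adj u w → u ∈ l := by
    intro u hu w hw ha
    by_contra hnu
    obtain ⟨d, hd, hdc⟩ := aux_extend G c hcc (hcp.nodup_iff.2 hn) hcl u w
      (by rwa [hcp.mem_iff]) (by rwa [hcp.mem_iff]) ha
    have := hmax (p+1) ⟨d, hd.nodup_iff.2 (by simp [hcp.mem_iff, hnu, hcp.nodup_iff, hn]), hdc, by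
      intro x hx
      rw [hd.mem_iff] at hx
      simp [hcp.mem_iff] at hx
      rcases hx with rfl | hx
      · exact hu
      · exact hlS x hx, by rw [hd.length_eq]; simp [hcp.length_eq, hlen]⟩
    omega
  set T := l.toFinset with hT
  have hTS : T ⊆ S := by intro x hx; exact hlS x (by simpa [hT] using hx)
  have hTc : #T = p := by rw [hT, List.toFinset_card_of_nodup hn, hlen]
  have hsd : #(S \ T) + #T = #S := card_sdiff_add_card_eq_card hTS
  have hrec := ih (#(S \ T)) (by omega) (S \ T) rfl
      (fun l a b c => h l a b (fun x hx => (mem_sdiff.1 (c x hx)).1))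
  rw [← sum_sdiff hTS, ← hsd, Nat.mul_add]
  apply Nat.add_le_add
  · refine le_trans (le_of_eq (sum_congr rfl ?_)) hrec
    intro v hv
    congr 1
    ext u
    simp only [mem_filter, mem_sdiff, hT, List.mem_toFinset] at hv ⊢
    constructor
    · rintro ⟨a, b⟩
      exact ⟨⟨a, fun hu => hv.2 (hclosed v hv.1 u hu b)⟩, b⟩
    · rintro ⟨⟨a, _⟩, b⟩; exact ⟨a, b⟩
  · rw [mul_comm, ← smul_eq_mul]
    apply sum_le_card_nsmul
    intro v hv
    have : ({u ∈ S | G.Adj v u}) ⊆ T.erase v := by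
      intro u hu
      simp only [mem_filter, mem_erase, hT, List.mem_toFinset] at hu hv ⊢
      exact ⟨hu.2.ne', hclosed u hu.1 v hv hu.2.symm⟩
    have := card_le_card this
    rw [card_erase_of_mem hv] at this
    omega

open Finset Classical in
noncomputable def auxN {V : Type*} (G : SimpleGraph V) (S : Finset V) (k : ℕ) : Finset (Finset V) :=
  {s ∈ S.powerset | G.IsNClique k s}

open Finset Classical in
theorem auxN_sum {V : Type*} (G : SimpleGraph V) (S : Finset V) (k : ℕ) :
    ∑ v ∈ S, #(auxN G {u ∈ S | G.Adj v u} k) = (k + 1) * #(auxN G S (k + 1)) := by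
  have h1 : ∀ v ∈ S, #(auxN G {u ∈ S | G.Adj v u} k) = #{s ∈ auxN G S (k+1) | v ∈ s} := by
    intro v hv
    refine card_bij' (fun s _ => insert v s) (fun s _ => s.erase v) ?_ ?_ ?_ ?_
    · intro s hs
      simp only [auxN, mem_filter, mem_powerset] at hs ⊢
      refine ⟨⟨insert_subset hv (hs.1.trans (filter_subset _ _)), ?_⟩, mem_insert_self _ _⟩
      exact hs.2.insert (fun b hb => (mem_filter.1 (hs.1 hb)).2)
    · intro s hs
      simp only [auxN, mem_filter, mem_powerset] at hs ⊢
      refine ⟨?_, by simpa using hs.1.2.erase_of_mem hs.2⟩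
      intro u hu
      rw [mem_erase] at hu
      rw [mem_filter]
      exact ⟨hs.1.1 hu.2, hs.1.2.isClique hs.2 hu.2 hu.1.symm⟩
    · intro s hs
      simp only [auxN, mem_filter, mem_powerset] at hs
      apply erase_insert
      intro hvs
      exact G.loopless.irrefl _ (mem_filter.1 (hs.1 hvs)).2
    · intro s hs
      exact insert_erase (mem_filter.1 hs).2
  rw [sum_congr rfl h1]
  have := sum_card_bipartiteAbove_eq_sum_card_bipartiteBelow (s := S) (t := auxN G S (k+1)) (fun v s => v ∈ s)
  simp only [bipartiteAbove, bipartiteBelow] at this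
  rw [this, mul_comm, ← smul_eq_mul, ← sum_const]
  apply sum_congr rfl
  intro s hs
  simp only [auxN, mem_filter, mem_powerset] at hs
  rw [filter_mem_eq_inter, inter_eq_right.2 hs.1, hs.2.card_eq]

open Finset Classical in
theorem auxN_exists {V : Type*} (G : SimpleGraph V) (S : Finset V) (k m : ℕ)
    (h : m * #(auxN G S (k+1)) < (k + 2) * #(auxN G S (k + 2))) :
    ∃ v ∈ S, m * #(auxN G {u ∈ S | G.Adj v u} k) < (k+1) * #(auxN G {u ∈ S | G.Adj v u} (k+1)) := by
  apply exists_lt_of_sum_lt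
  rw [← mul_sum, ← mul_sum, auxN_sum, auxN_sum]
  nlinarith

open Finset Classical in
theorem auxN_one {V : Type*} (G : SimpleGraph V) (S : Finset V) : #(auxN G S 1) = #S := by
  have h : auxN G S 1 = S.image (fun v => {v}) := by
    ext s
    simp only [auxN, mem_filter, mem_powerset, SimpleGraph.isNClique_one, mem_image]
    constructor
    · rintro ⟨h, a, rfl⟩; exact ⟨a, by simpa using h, rfl⟩
    · rintro ⟨a, h, rfl⟩; exact ⟨by simpa using h, a, rfl⟩
  rw [h, card_image_of_injective _ singleton_injective]

open Finset Classical in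
theorem aux_path {V : Type*} (G : SimpleGraph V) (m k : ℕ) : ∀ (S : Finset V),
    m * #(auxN G S (k+1)) < (k + 2) * #(auxN G S (k + 2)) →
    ∃ l : List V, l.Nodup ∧ l.IsChain G.Adj ∧ (∀ x ∈ l, x ∈ S) ∧ l.length = m + k + 2 := by
  induction k with
  | zero =>
    intro S h
    by_contra hcon
    have := aux_EG G m _ S rfl (by
      intro l hn hc hS
      by_contra hlt
      exact hcon ⟨l.take (m+2), hn.sublist (List.take_sublist _ _), hc.take _,
        fun x hx => hS x (List.mem_of_mem_take hx), by rw [List.length_take]; omega⟩)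
    have h2 := auxN_sum G S 1
    simp only [auxN_one, zero_add, Nat.reduceAdd] at h2 h
    omega
  | succ k ih =>
    intro S h
    obtain ⟨v, hv, hlt⟩ := auxN_exists G S (k+1) m h
    obtain ⟨l, hn, hc, hS, hlen⟩ := ih _ hlt
    simp only [mem_filter] at hS
    refine ⟨v :: l, ?_, ?_, ?_, by simp [hlen]; omega⟩
    · simp only [List.nodup_cons]
      exact ⟨fun hvl => G.loopless.irrefl _ (hS v hvl).2, hn⟩
    · rw [List.isChain_cons]
      exact ⟨fun y hy => (hS y (List.mem_of_mem_head? hy)).2, hc⟩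
    · intro x hx
      rcases List.mem_cons.1 hx with rfl | hx
      · exact hv
      · exact (hS x hx).1

theorem aux_walk {V : Type*} (G : SimpleGraph V) (l : List V) : ∀ a : V,
    (a :: l).IsChain G.Adj → ∃ b, ∃ w : G.Walk a b, w.support = a :: l := by
  induction l with
  | nil => intro a _; exact ⟨a, .nil, rfl⟩
  | cons c l ih =>
    intro a h
    rw [List.isChain_cons_cons] at h
    obtain ⟨b, w, hw⟩ := ih c h.2
    exact ⟨b, .cons h.1 w, by simp [hw]⟩

theorem aux_cycle {V : Type*} (G : SimpleGraph V) (v : V) (l : List V) (hn : l.Nodup)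
    (hc : l.IsChain G.Adj) (hv : ∀ x ∈ l, G.Adj v x) (hlen : 2 ≤ l.length) :
    ∃ c : G.Walk v v, c.IsCycle ∧ c.length = l.length + 1 := by
  obtain _ | ⟨a, l⟩ := l
  · simp at hlen
  obtain ⟨b, w, hw⟩ := aux_walk G l a hc
  have hb : b ∈ a :: l := by rw [← hw]; exact w.end_mem_support
  have hwl : w.length = l.length := by
    have := w.length_support
    rw [hw] at this; simpa using this.symm
  have hvw : v ∉ w.support := by
    rw [hw]; intro h; exact G.loopless.irrefl _ (hv v h)
  have hwp : w.IsPath := by rw [SimpleGraph.Walk.isPath_def, hw]; exact hn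
  refine ⟨.cons (hv a (by simp)) (w.concat (hv b hb).symm), ?_, by simp [hwl]⟩
  rw [SimpleGraph.Walk.cons_isCycle_iff]
  refine ⟨hwp.concat hvw _, ?_⟩
  rw [SimpleGraph.Walk.edges_concat]
  simp only [List.concat_eq_append, List.mem_append, List.mem_singleton, not_or]
  refine ⟨fun h => hvw (w.fst_mem_support_of_mem_edges h), ?_⟩
  intro h
  have hab : a = b := by
    rw [Sym2.eq_swap, Sym2.congr_left] at h
    exact h
  subst hab
  rw [SimpleGraph.Walk.isPath_iff_eq_nil] at hwp
  subst hwp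
  simp at hwl hlen
  simp [← hwl] at hlen

/-- For `2 ≤ k ≤ ω(G)`, the graph `G` contains a cycle of length `t` for every
`t` with `3 ≤ t ≤ ⌈(k+1)·N_{k+1}(G)/N_k(G)⌉ + k`. -/
theorem cycles_of_cliqueCounts {V : Type*} [Fintype V] (G : SimpleGraph V)
    (k : ℕ) (hk : 2 ≤ k) (hkω : k ≤ G.cliqueNum) (t : ℕ) (ht3 : 3 ≤ t)
    (ht : (t : ℤ) ≤ ⌈((k + 1 : ℚ) * cliqueCount G (k + 1)) / (cliqueCount G k : ℚ)⌉ + k) :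
    ∃ (v : V) (c : G.Walk v v), c.IsCycle ∧ c.length = t := by
  classical
  suffices h : ∃ (v : V) (l : List V), l.Nodup ∧ l.IsChain G.Adj ∧ (∀ x ∈ l, G.Adj v x) ∧
      l.length + 1 = t by
    obtain ⟨v, l, h1, h2, h3, h4⟩ := h
    obtain ⟨c, hc, hl⟩ := aux_cycle G v l h1 h2 h3 (by omega)
    exact ⟨v, c, hc, by omega⟩
  by_cases htk : t ≤ k
  · obtain ⟨s, hs⟩ := G.exists_isNClique_cliqueNum
    obtain ⟨r, hrs, hr⟩ := Finset.exists_subset_card_eq (s := s) (n := t) (by rw [hs.card_eq]; omega)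
    have hrc : G.IsClique (r : Set V) := hs.isClique.subset (by exact_mod_cast hrs)
    have hrl : r.toList.length = t := by simp [hr]
    have hnd := r.nodup_toList
    have hpw : r.toList.Pairwise G.Adj := by
      refine List.Pairwise.imp_of_mem ?_ hnd
      intro a b ha hb hab
      exact hrc (by simpa using ha) (by simpa using hb) hab
    generalize r.toList = L at *
    obtain _ | ⟨v, l⟩ := L
    · simp at hrl; omega
    rw [List.pairwise_cons] at hpw
    exact ⟨v, l, (List.nodup_cons.1 hnd).2, hpw.2.isChain, hpw.1, by simpa using hrl⟩
  · have hcc : ∀ j, cliqueCount G j = (auxN G Finset.univ j).card := by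
      intro j
      rw [cliqueCount, ← Set.ncard_coe_finset]
      congr 1
      ext s
      simp [auxN]
    obtain ⟨m, rfl⟩ : ∃ m, t = m + k + 1 := ⟨t - k - 1, by omega⟩
    have hlt : (m : ℤ) < ⌈((k + 1 : ℚ) * cliqueCount G (k + 1)) / (cliqueCount G k : ℚ)⌉ := by
      push_cast at ht; omega
    rw [Int.lt_ceil] at hlt
    have hpos : 0 < (cliqueCount G k : ℚ) := by
      rcases Nat.eq_zero_or_pos (cliqueCount G k) with h0 | h0
      · rw [h0] at hlt
        rw [Nat.cast_zero, div_zero] at hlt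
        have : (0 : ℚ) ≤ ((m : ℤ) : ℚ) := by positivity
        exact absurd hlt (not_lt.2 this)
      · exact_mod_cast h0
    rw [lt_div_iff₀ hpos] at hlt
    have hlt' : m * cliqueCount G k < (k + 1) * cliqueCount G (k + 1) := by exact_mod_cast hlt
    rw [hcc, hcc] at hlt'
    obtain ⟨q, rfl⟩ : ∃ q, k = q + 2 := ⟨k - 2, by omega⟩
    obtain ⟨v, -, hv⟩ := auxN_exists G Finset.univ (q+1) m hlt'
    obtain ⟨l, h1, h2, h3, h4⟩ := aux_path G m q _ hv
    exact ⟨v, l, h1, h2, fun x hx => (Finset.mem_filter.1 (h3 x hx)).2, by omega⟩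
end

section
/- Let l ≥ 3 and s ≥ 2 be integers. If G is a simple graph on n vertices containing no cycle of length at least l, then the number of copies of K_s in G satisfies N_s(G) ≤ ((n-1)/(l-2))·C(l-1, s). -/
theorem luo_exists_max (p : ℕ → Prop) (b : ℕ) (h : ∃ n, p n) (hb : ∀ n, p n → n ≤ b) :
    ∃ n, p n ∧ ∀ m, p m → m ≤ n := by
  classical
  obtain ⟨n, hn⟩ := h
  exact ⟨Nat.findGreatest p b, Nat.findGreatest_spec (hb n hn) hn,
    fun m hm => Nat.le_findGreatest (hb m hm) hm⟩

theorem luo_count {α : Type*} (p : α → Bool) (R : List α)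
    (h : ∀ C z z' D, R = C ++ z :: z' :: D → ¬ (p z ∧ p z')) :
    2 * R.countP p ≤ R.length + 1 := by
  induction R using List.twoStepInduction with
  | nil => simp
  | singleton a => by_cases h : p a <;> simp [h]
  | cons_cons a b R ih _ =>
    have h1 := ih (fun C z z' D e => h (a :: b :: C) z z' D (by simp [e]))
    have h2 := h [] a b R rfl
    simp only [List.countP_cons, List.length_cons]
    by_cases ha : p a <;> by_cases hb : p b <;> simp_all <;> omega

theorem luo_binom1 (k d : ℕ) (h : 2 * d ≤ k) (hk : 2 ≤ k) (r : ℕ) :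
    (k - 1) * d.choose (r + 1) ≤ k.choose (r + 2) := by
  induction r with
  | zero =>
    have := Nat.choose_two_right k
    have h2 : k * (k - 1) = 2 * k.choose 2 := by
      rw [this, Nat.mul_div_cancel' (Nat.even_mul_pred_self k).two_dvd]
    simp only [zero_add, Nat.choose_one_right]
    nlinarith [Nat.mul_le_mul_right (k - 1) h]
  | succ r ih =>
    by_cases hd : d ≤ r + 1
    · rw [Nat.choose_eq_zero_of_lt (by omega : d < r + 1 + 1)]; simp
    have e1 := Nat.choose_succ_right_eq d (r + 1)
    have e2 := Nat.choose_succ_right_eq k (r + 2)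
    obtain ⟨a, rfl⟩ : ∃ a, d = r + 2 + a := ⟨d - (r + 2), by omega⟩
    obtain ⟨c, rfl⟩ : ∃ c, k = 2 * (r + 2 + a) + c := ⟨k - 2 * (r + 2 + a), by omega⟩
    have s1 : r + 2 + a - (r + 1) = a + 1 := by omega
    have s2 : 2 * (r + 2 + a) + c - (r + 2) = r + 2 + 2 * a + c := by omega
    rw [s1] at e1
    rw [s2] at e2
    generalize (r + 2 + a).choose (r + 1) = x at *
    generalize (r + 2 + a).choose (r + 1 + 1) = x' at *
    generalize (2 * (r + 2 + a) + c).choose (r + 2) = y at *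
    change _ ≤ (2 * (r + 2 + a) + c).choose (r + 2 + 1)
    generalize (2 * (r + 2 + a) + c).choose (r + 2 + 1) = y' at *
    generalize 2 * (r + 2 + a) + c - 1 = q at *
    have hpos : 0 < (r + 2) * (r + 3) := by positivity
    refine Nat.le_of_mul_le_mul_right ?_ hpos
    calc q * x' * ((r + 2) * (r + 3)) = q * (x' * (r + 1 + 1)) * (r + 3) := by ring
      _ = (q * x) * ((a + 1) * (r + 3)) := by rw [e1]; ring
      _ ≤ y * ((a + 1) * (r + 3)) := Nat.mul_le_mul_right _ ih
      _ ≤ y * ((r + 2 + 2 * a + c) * (r + 2)) := by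
          apply Nat.mul_le_mul_left
          nlinarith [Nat.zero_le (a * r), Nat.zero_le (r * r), Nat.zero_le (c * r)]
      _ = (y * (r + 2 + 2 * a + c)) * (r + 2) := by ring
      _ = y' * ((r + 2) * (r + 3)) := by rw [← e2]; ring

theorem luo_binom2 (k t : ℕ) (ht : 1 ≤ t) (h : t + 1 ≤ k) (r : ℕ) :
    (k - 1) * (t + 1).choose (r + 2) ≤ t * k.choose (r + 2) := by
  obtain ⟨k, rfl⟩ : ∃ j, k = j + 2 := ⟨k - 2, by omega⟩
  obtain ⟨t, rfl⟩ : ∃ j, t = j + 1 := ⟨t - 1, by omega⟩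
  have key : ∀ m : ℕ, (m + 2).choose (r + 2) * ((r + 2) * (r + 1)) =
      (m + 2) * (m + 1) * m.choose r := by
    intro m
    have e1 := Nat.add_one_mul_choose_eq m r
    have e2 := Nat.add_one_mul_choose_eq (m + 1) (r + 1)
    calc _ = ((m + 1 + 1).choose (r + 1 + 1) * (r + 1 + 1)) * (r + 1) := by ring
      _ = (m + 2) * ((m + 1).choose (r + 1) * (r + 1)) := by rw [← e2]; ring
      _ = _ := by rw [← e1]; ring
  have hpos : 0 < (r + 2) * (r + 1) := by positivity
  refine Nat.le_of_mul_le_mul_right ?_ hpos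
  have hc : t.choose r ≤ k.choose r := Nat.choose_le_choose r (by omega)
  have hs : k + 2 - 1 = k + 1 := rfl
  rw [hs]
  calc _ = (k + 1) * ((t + 2).choose (r + 2) * ((r + 2) * (r + 1))) := by ring
    _ = (k + 1) * (t + 1) * ((t + 2) * t.choose r) := by rw [key]; ring
    _ ≤ (k + 1) * (t + 1) * ((k + 2) * k.choose r) := by
        apply Nat.mul_le_mul_left
        exact Nat.mul_le_mul (by omega) hc
    _ = (t + 1) * ((k + 2).choose (r + 2) * ((r + 2) * (r + 1))) := by rw [key]; ring
    _ = _ := by ring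

theorem luo_cycle_of_list {V : Type*} (G : SimpleGraph V) (x w : V) (A : List V)
    (hA : A ≠ []) (hn : (x :: A ++ [w]).Nodup) (hc : (x :: A ++ [w]).IsChain G.Adj)
    (hxw : G.Adj x w) :
    ∃ (v : V) (c : G.Walk v v), c.IsCycle ∧ c.length = A.length + 2 := by
  have key : ∀ (L : List V) (hne : L ≠ []) (u v : V) (_ : L.head hne = u) (_ : L.getLast hne = v)
      (_ : L.IsChain G.Adj), ∃ p : G.Walk u v, p.support = L := by
    rintro L hne u v rfl rfl h
    exact ⟨SimpleGraph.Walk.ofSupport L hne h, SimpleGraph.Walk.support_ofSupport hne h⟩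
  obtain ⟨p, hp⟩ := key (x :: A ++ [w]) (by simp) x w (by simp) (by simp) hc
  have hl : p.length = A.length + 1 := by
    have := p.length_support
    rw [hp] at this
    simp at this
    omega
  have hpath : p.IsPath := by rw [SimpleGraph.Walk.isPath_def, hp]; exact hn
  refine ⟨w, SimpleGraph.Walk.cons hxw.symm p, ?_, by simp [hl]⟩
  rw [SimpleGraph.Walk.isCycle_iff_isPath_tail_and_le_length]
  have : 0 < A.length := List.length_pos_iff.2 hA
  refine ⟨by simpa using hpath, by simp [hl]; omega⟩

theorem luo_rot {V : Type*} (G : SimpleGraph V) (x b : V) (A B : List V)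
    (hc : (x :: A ++ b :: B).IsChain G.Adj) (h : G.Adj x b) :
    (A.reverse ++ x :: b :: B).IsChain G.Adj := by
  rw [List.isChain_append_cons_cons]
  rw [List.isChain_append] at hc
  refine ⟨?_, h, hc.2.1⟩
  have : A.reverse ++ [x] = (x :: A).reverse := by simp
  rw [this, List.isChain_reverse]
  refine hc.1.imp fun a b h => h.symm

theorem luo_structure {V : Type*} [DecidableEq V] (G : SimpleGraph V) [DecidableRel G.Adj]
    (U : Finset V) (k : ℕ) (hk : 2 ≤ k) (hU : U.Nonempty)
    (hG : ∀ (v : V) (c : G.Walk v v), c.IsCycle → c.length ≤ k)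
    (hdeg : ∀ v ∈ U, k < 2 * (U.filter (G.Adj v)).card) :
    ∃ (P : List V) (w : V), (P ++ [w]).Nodup ∧ (∀ x ∈ P ++ [w], x ∈ U) ∧ 1 ≤ P.length ∧
      P.length + 1 ≤ k ∧ ∀ y ∈ P, ∀ z ∈ U, G.Adj y z → z ∈ P ++ [w] := by
  obtain ⟨M, ⟨L0, ⟨hL0n, hL0c, hL0U⟩, hL0l⟩, hM⟩ := luo_exists_max
    (fun m => ∃ L : List V, (L.Nodup ∧ L.IsChain G.Adj ∧ ∀ x ∈ L, x ∈ U) ∧ L.length = m) U.card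
    ⟨0, [], by simp⟩ (by
      rintro n ⟨L, ⟨h1, h2, h3⟩, rfl⟩
      rw [← List.toFinset_card_of_nodup h1]
      exact Finset.card_le_card (fun x hx => h3 x (by simpa using hx)))
  have hext : ∀ x L z, (x :: L).Nodup → (x :: L).IsChain G.Adj → (∀ a ∈ x :: L, a ∈ U) →
      (x :: L).length = M → z ∈ U → G.Adj x z → z ∈ L := by
    intro x L z h1 h2 h3 h4 h5 h6
    by_contra hz
    have hzx : z ≠ x := fun e => G.loopless.irrefl x (e ▸ h6)
    have := hM (M + 1) ⟨z :: x :: L, ⟨by simp_all, by simpa [h2] using h6.symm, by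
      intro a ha
      rcases List.mem_cons.1 ha with rfl | ha
      · exact h5
      · exact h3 a ha⟩, by simp [← h4]⟩
    omega
  obtain ⟨t, ⟨P, w, Q, x0, P', ⟨hn, hc, hPU⟩, hlen, hPt, hPx, hxw⟩, hmax⟩ := luo_exists_max
    (fun t => ∃ (P : List V) (w : V) (Q : List V) (x : V) (P' : List V),
      ((P ++ w :: Q).Nodup ∧ (P ++ w :: Q).IsChain G.Adj ∧ ∀ a ∈ P ++ w :: Q, a ∈ U) ∧
      (P ++ w :: Q).length = M ∧ P.length = t ∧ P = x :: P' ∧ G.Adj x w) M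
    (by
      have hne : L0 ≠ [] := by
        rintro rfl
        obtain ⟨u, hu⟩ := hU
        have := hM 1 ⟨[u], by simp [hu], by simp⟩
        simp at hL0l
        omega
      obtain ⟨x, L, rfl⟩ := List.exists_cons_of_ne_nil hne
      have hx : x ∈ U := hL0U x (by simp)
      have hd := hdeg x hx
      obtain ⟨b, hb⟩ := Finset.card_pos.1 (by omega : 0 < (U.filter (G.Adj x)).card)
      rw [Finset.mem_filter] at hb
      obtain ⟨A, B, rfl⟩ := List.append_of_mem (hext x L b hL0n hL0c hL0U hL0l hb.1 hb.2)
      exact ⟨_, x :: A, b, B, x, A, ⟨by simpa using hL0n, by simpa using hL0c,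
        by simpa using hL0U⟩, by simpa using hL0l, rfl, rfl, hb.2⟩)
    (by
      rintro n ⟨P, w, Q, x, P', -, h1, rfl, -⟩
      simp at h1
      omega)
  have hnbr : ∀ x L z, (x :: L).Perm P → (x :: L ++ w :: Q).IsChain G.Adj → z ∈ U → G.Adj x z →
      z ∈ L ++ [w] := by
    intro x L z hp hch hz hxz
    have hperm : (x :: L ++ w :: Q).Perm (P ++ w :: Q) := hp.append_right _
    have h1 : (x :: L ++ w :: Q).Nodup := hperm.nodup_iff.2 hn
    have h2 : ∀ a ∈ x :: L ++ w :: Q, a ∈ U := fun a ha => hPU a (hperm.mem_iff.1 ha)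
    have h3 : (x :: L ++ w :: Q).length = M := by rw [hperm.length_eq, hlen]
    have h4 := hext x (L ++ w :: Q) z h1 hch h2 h3 hz hxz
    by_contra hcon
    have hzQ : z ∈ Q := by
      simp only [List.mem_append, List.mem_cons, List.not_mem_nil, or_false] at h4 hcon
      tauto
    obtain ⟨Q1, Q2, rfl⟩ := List.append_of_mem hzQ
    have := hmax _ ⟨x :: L ++ w :: Q1, z, Q2, x, L ++ w :: Q1, ⟨by simpa using h1,
      by simpa using hch, by simpa using h2⟩, by simpa using h3, rfl, by simp, hxz⟩
    have hl := hp.length_eq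
    simp at this hl
    omega
  have hcount : ∀ x L, (x :: L).Perm P → (x :: L ++ w :: Q).IsChain G.Adj →
      k < 2 * (L ++ [w]).countP (fun z => decide (G.Adj x z)) := by
    intro x L hp hch
    have hx : x ∈ U := hPU x (by simp [← hp.mem_iff])
    refine (hdeg x hx).trans_le (Nat.mul_le_mul_left 2 ?_)
    rw [List.countP_eq_length_filter]
    refine le_trans (Finset.card_le_card ?_) (List.toFinset_card_le _)
    intro z hz
    rw [Finset.mem_filter] at hz
    rw [List.mem_toFinset, List.mem_filter]
    exact ⟨hnbr x L z hp hch hz.1 hz.2, by simpa using hz.2⟩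
  have hPlen : P.length = P'.length + 1 := by rw [hPx]; simp
  have hP2 : 2 ≤ P.length := by
    have h1 := hcount x0 P' (by rw [hPx]) (by rw [← hPx]; exact hc)
    have h2 := List.countP_le_length (p := fun z => decide (G.Adj x0 z)) (l := P' ++ [w])
    simp only [List.length_append, List.length_singleton] at h2
    omega
  have hPk : P.length + 1 ≤ k := by
    have hsplit : P ++ w :: Q = (x0 :: P' ++ [w]) ++ Q := by rw [hPx]; simp
    obtain ⟨v, c, hc1, hc2⟩ := luo_cycle_of_list G x0 w P'
      (by rintro rfl; simp at hPlen; omega)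
      (by rw [hsplit] at hn; exact hn.of_append_left)
      (by rw [hsplit] at hc; exact hc.left_of_append) hxw
    have := hG v c hc1
    omega
  have hsplit : P ++ w :: Q = (P ++ [w]) ++ Q := by simp
  refine ⟨P, w, by rw [hsplit] at hn; exact hn.of_append_left,
    fun x hx => hPU x (by rw [hsplit]; exact List.mem_append_left _ hx), by omega, hPk, ?_⟩
  intro y hy z hz hyz
  classical
  have hex0 : ∃ j, (∃ A B, (A ++ y :: B).Perm P ∧ (A ++ y :: B ++ w :: Q).IsChain G.Adj ∧
      A.length = j) ∧ 2 * j + 1 ≤ P.length := by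
    obtain ⟨A, B, hAB⟩ := List.append_of_mem hy
    have hl : P.length = A.length + B.length + 1 := by rw [hAB]; simp; omega
    by_cases hA : 2 * A.length + 1 ≤ P.length
    · exact ⟨A.length, ⟨A, B, by rw [hAB], by rw [← hAB]; exact hc, rfl⟩, hA⟩
    · refine ⟨B.length, ⟨B.reverse, A.reverse, ?_, ?_, by simp⟩, by omega⟩
      · rw [hAB]
        have : B.reverse ++ y :: A.reverse = (A ++ y :: B).reverse := by simp
        rw [this]
        exact List.reverse_perm _
      · have h1 := luo_rot G x0 w P' Q (by rw [← hPx]; exact hc) hxw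
        have : B.reverse ++ y :: A.reverse ++ w :: Q = P'.reverse ++ x0 :: w :: Q := by
          have e : B.reverse ++ y :: A.reverse = (x0 :: P').reverse := by
            rw [← hPx, hAB]; simp
          rw [e]; simp
        rw [this]; exact h1
  have hex : ∃ j, ∃ A B, (A ++ y :: B).Perm P ∧ (A ++ y :: B ++ w :: Q).IsChain G.Adj ∧
      A.length = j := hex0.imp fun j h => h.1
  obtain ⟨A, B, hp, hch, hAl⟩ := Nat.find_spec hex
  have hmin : ∀ A' B', (A' ++ y :: B').Perm P → (A' ++ y :: B' ++ w :: Q).IsChain G.Adj →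
      A.length ≤ A'.length := by
    intro A' B' h1 h2
    rw [hAl]
    exact Nat.find_min' hex ⟨A', B', h1, h2, rfl⟩
  have hj : 2 * A.length + 1 ≤ P.length := by
    obtain ⟨j, h1, h2⟩ := hex0
    have := Nat.find_min' hex h1
    omega
  have hpl := hp.length_eq
  rcases A with _ | ⟨x, A⟩
  · have := hnbr y B z (by simpa using hp) (by simpa using hch) hz hyz
    have h2 : z ∈ (y :: B) ++ [w] := by
      rw [List.cons_append]; exact List.mem_cons_of_mem _ this
    have h3 : ((y :: B) ++ [w]).Perm (P ++ [w]) := List.Perm.append_right _ (by simpa using hp)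
    exact h3.mem_iff.1 h2
  exfalso
  have hcnt := hcount x (A ++ y :: B) (by simpa using hp) (by simpa using hch)
  have e1 : A ++ y :: B ++ [w] = (A ++ [y]) ++ (B ++ [w]) := by simp
  rw [e1, List.countP_append (l₁ := A ++ [y]), ← List.take_append_drop (A.length + 1) (B ++ [w]),
    List.countP_append (l₁ := (B ++ [w]).take (A.length + 1))] at hcnt
  have c1 := List.countP_le_length (p := fun z => decide (G.Adj x z)) (l := A ++ [y])
  -- splitting facts
  have hfar : ∀ C z D, B ++ [w] = C ++ z :: D → G.Adj x z → A.length + 1 ≤ C.length := by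
    intro C z D hB hxz
    by_contra hlt
    have hch' : (x :: (A ++ y :: C) ++ z :: (D ++ Q)).IsChain G.Adj := by
      have : x :: (A ++ y :: C) ++ z :: (D ++ Q) = x :: A ++ y :: B ++ w :: Q := by
        have : x :: A ++ y :: B ++ w :: Q = x :: A ++ y :: (B ++ [w]) ++ Q := by simp
        rw [this, hB]; simp
      rw [this]; exact hch
    have hr := luo_rot G x z _ _ hch' hxz
    -- D = D' ++ [w] or (D = [] and z = w)
    rcases List.eq_nil_or_concat D with rfl | ⟨D', d, rfl⟩
    · obtain ⟨rfl, hzw⟩ := List.append_inj' hB rfl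
      simp at hzw
      subst hzw
      have := hmin B.reverse (A.reverse ++ [x]) (by
        refine List.Perm.trans ?_ hp
        have : B.reverse ++ y :: (A.reverse ++ [x]) = (x :: A ++ y :: B).reverse := by simp
        rw [this]; exact List.reverse_perm _) (by simpa using hr)
      simp at this
      omega
    · have hB' : B ++ [w] = (C ++ z :: D') ++ [d] := by rw [hB]; simp
      obtain ⟨rfl, hzw⟩ := List.append_inj' hB' rfl
      simp at hzw
      subst hzw
      have := hmin C.reverse (A.reverse ++ x :: z :: D') (by
        refine List.Perm.trans ?_ hp
        rw [List.perm_iff_count]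
        intro a
        simp [List.count_append, List.count_cons]
        omega) (by simpa using hr)
      simp at this
      omega
  have c2 : ((B ++ [w]).take (A.length + 1)).countP (fun z => decide (G.Adj x z)) = 0 := by
    rw [List.countP_eq_zero]
    intro a ha hxa
    obtain ⟨C, D, hCD⟩ := List.append_of_mem ha
    have h1 := hfar C a (D ++ (B ++ [w]).drop (A.length + 1)) (by
      conv_lhs => rw [← List.take_append_drop (A.length + 1) (B ++ [w]), hCD]
      simp) (by simpa using hxa)
    have h2 : ((B ++ [w]).take (A.length + 1)).length ≤ A.length + 1 := by
      rw [List.length_take]; exact min_le_left _ _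
    rw [hCD] at h2
    simp at h2
    omega
  have c3 := luo_count (fun z => decide (G.Adj x z)) ((B ++ [w]).drop (A.length + 1)) (by
    rintro C z z' D hE ⟨hxz, hxz'⟩
    simp only [decide_eq_true_eq] at hxz hxz'
    obtain ⟨C', hC'⟩ : ∃ C', B ++ [w] = C' ++ z :: z' :: D :=
      ⟨(B ++ [w]).take (A.length + 1) ++ C, by
        conv_lhs => rw [← List.take_append_drop (A.length + 1) (B ++ [w]), hE]
        simp⟩
    have hch' : ((x :: A ++ y :: C') ++ z :: z' :: (D ++ Q)).IsChain G.Adj := by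
      have : (x :: A ++ y :: C') ++ z :: z' :: (D ++ Q) = x :: A ++ y :: B ++ w :: Q := by
        have : x :: A ++ y :: B ++ w :: Q = x :: A ++ y :: (B ++ [w]) ++ Q := by simp
        rw [this, hC']; simp
      rw [this]; exact hch
    rw [List.isChain_append_cons_cons] at hch'
    obtain ⟨g1, g2, g3⟩ := hch'
    have g1' : ((A ++ y :: C') ++ [z]).IsChain G.Adj := by
      have : x :: A ++ y :: C' ++ [z] = [x] ++ ((A ++ y :: C') ++ [z]) := by simp
      rw [this] at g1
      exact g1.right_of_append
    have g4 : ((A ++ y :: C') ++ z :: x :: z' :: (D ++ Q)).IsChain G.Adj := by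
      rw [List.isChain_append_cons_cons]
      exact ⟨g1', hxz.symm, List.isChain_cons_cons.2 ⟨hxz', g3⟩⟩
    rcases List.eq_nil_or_concat D with rfl | ⟨D', d, rfl⟩
    · have hB' : B ++ [w] = (C' ++ [z]) ++ [z'] := by rw [hC']; simp
      obtain ⟨rfl, hzw⟩ := List.append_inj' hB' rfl
      simp at hzw
      subst hzw
      have := hmin A (C' ++ [z, x]) (by
        refine List.Perm.trans ?_ hp
        rw [List.perm_iff_count]
        intro a
        simp [List.count_append, List.count_cons]
        omega) (by simpa using g4)
      simp at this
    · have hB' : B ++ [w] = (C' ++ z :: z' :: D') ++ [d] := by rw [hC']; simp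
      obtain ⟨rfl, hzw⟩ := List.append_inj' hB' rfl
      simp at hzw
      subst hzw
      have := hmin A (C' ++ z :: x :: z' :: D') (by
        refine List.Perm.trans ?_ hp
        rw [List.perm_iff_count]
        intro a
        simp [List.count_append, List.count_cons]
        omega) (by simpa using g4)
      simp at this)
  simp only [List.length_append, List.length_cons, List.length_drop, List.length_nil] at c1 c3 hpl hj
  omega

open Classical in
theorem luo_finset {V : Type*} (G : SimpleGraph V)
    (k r : ℕ) (hk : 2 ≤ k)
    (hG : ∀ (v : V) (c : G.Walk v v), c.IsCycle → c.length ≤ k) (N : ℕ) :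
    ∀ U : Finset V, U.card = N →
    (k - 1) * ((U.powersetCard (r + 2)).filter (fun T : Finset V => G.IsClique (T : Set V))).card ≤
      (U.card - 1) * k.choose (r + 2) := by
  induction N using Nat.strong_induction_on with
  | _ N ih =>
  rintro U rfl
  by_cases hU : U.card ≤ 1
  · rw [Finset.powersetCard_eq_empty.2 (by omega)]
    simp
  -- deletion step
  have del : ∀ S : Finset V, S ⊆ U → 1 ≤ S.card → S.card < U.card →
      (k - 1) * (((U.powersetCard (r + 2)).filter (fun T : Finset V => G.IsClique (T : Set V))).filter
        (fun T => ¬ Disjoint T S)).card ≤ S.card * k.choose (r + 2) →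
      (k - 1) * ((U.powersetCard (r + 2)).filter (fun T : Finset V => G.IsClique (T : Set V))).card ≤
      (U.card - 1) * k.choose (r + 2) := by
    intro S hS h1 h2 h3
    have hc : (U \ S).card = U.card - S.card := Finset.card_sdiff_of_subset hS
    have h4 := ih _ (by omega : (U \ S).card < U.card) (U \ S) rfl
    have h5 : ((U.powersetCard (r + 2)).filter (fun T : Finset V => G.IsClique (T : Set V))).filter
        (fun T => Disjoint T S) ⊆
        ((U \ S).powersetCard (r + 2)).filter (fun T : Finset V => G.IsClique (T : Set V)) := by
      intro T hT
      simp only [Finset.mem_filter, Finset.mem_powersetCard] at hT ⊢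
      exact ⟨⟨Finset.subset_sdiff.2 ⟨hT.1.1.1, hT.2⟩, hT.1.1.2⟩, hT.1.2⟩
    have h6 := Nat.mul_le_mul_left (k - 1) (Finset.card_le_card h5)
    rw [← Finset.card_filter_add_card_filter_not (fun T => Disjoint T S), mul_add]
    have h7 : U.card - 1 = ((U \ S).card - 1) + S.card := by omega
    rw [h7, add_mul]
    omega
  by_cases hdeg : ∀ v ∈ U, k < 2 * (U.filter (G.Adj v)).card
  · obtain ⟨P, w, hn, hPU, hP1, hPk, hcl⟩ := luo_structure G U k hk
      (Finset.card_pos.1 (by omega)) hG hdeg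
    have hPn : P.Nodup := hn.of_append_left
    have hWc : (P ++ [w]).toFinset.card = P.length + 1 := by
      rw [List.toFinset_card_of_nodup hn]; simp
    have hWU : (P ++ [w]).toFinset ⊆ U := fun x hx => hPU x (List.mem_toFinset.1 hx)
    have hle := Finset.card_le_card hWU
    have hSc : P.toFinset.card = P.length := List.toFinset_card_of_nodup hPn
    refine del P.toFinset (fun x hx => hPU x (by simp at hx; simp [hx])) (by omega) (by omega) ?_
    rw [hSc]
    refine le_trans (Nat.mul_le_mul_left _ ?_) (luo_binom2 k P.length hP1 hPk r)
    rw [← hWc, ← Finset.card_powersetCard]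
    refine Finset.card_le_card ?_
    intro T hT
    simp only [Finset.mem_filter, Finset.mem_powersetCard] at hT ⊢
    obtain ⟨⟨⟨hTU, hTc⟩, hTcl⟩, hTS⟩ := hT
    refine ⟨?_, hTc⟩
    obtain ⟨y, hyT, hyP⟩ := Finset.not_disjoint_iff.1 hTS
    rw [List.mem_toFinset] at hyP
    intro z hz
    rw [List.mem_toFinset]
    by_cases hzy : y = z
    · subst hzy; simp [hyP]
    · exact hcl y hyP z (hTU hz) (hTcl (by exact_mod_cast hyT) (by exact_mod_cast hz) hzy)
  · push Not at hdeg
    obtain ⟨v, hv, hd⟩ := hdeg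
    refine del {v} (by simpa using hv) (by simp) (by simp; omega) ?_
    rw [Finset.card_singleton, one_mul]
    refine le_trans (Nat.mul_le_mul_left _ ?_) (luo_binom1 k _ hd hk r)
    rw [← Finset.card_powersetCard]
    refine Finset.card_le_card_of_injOn (fun T : Finset V => T.erase v) ?_ ?_
    · intro T hT
      simp only [Finset.coe_filter, Set.mem_setOf_eq, Finset.mem_filter, Finset.mem_powersetCard,
        Finset.disjoint_singleton_right, not_not] at hT
      obtain ⟨⟨⟨hTU, hTc⟩, hTcl⟩, hvT⟩ := hT
      rw [Finset.mem_coe, Finset.mem_powersetCard]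
      refine ⟨?_, by rw [Finset.card_erase_of_mem hvT, hTc]; rfl⟩
      intro z hz
      rw [Finset.mem_erase] at hz
      rw [Finset.mem_filter]
      exact ⟨hTU hz.2, hTcl (by exact_mod_cast hvT) (by exact_mod_cast hz.2) hz.1.symm⟩
    · intro T hT T' hT' h
      simp only [Finset.coe_filter, Set.mem_setOf_eq, Finset.mem_filter,
        Finset.disjoint_singleton_right, not_not] at hT hT'
      have h' : T.erase v = T'.erase v := h
      rw [← Finset.insert_erase hT.2, ← Finset.insert_erase hT'.2, h']

/-- Luo's theorem for cycles: if `G` has `n` vertices and no cycle of length at least `l`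
(where `l ≥ 3`, `s ≥ 2`), then `N_s(G) ≤ ((n-1)/(l-2))·C(l-1, s)`. -/
theorem luo_cycles {V : Type*} [Fintype V] (G : SimpleGraph V) (l s : ℕ)
    (hl : 3 ≤ l) (hs : 2 ≤ s)
    (hG : ∀ (v : V) (c : G.Walk v v), c.IsCycle → c.length < l) :
    (cliqueCount G s : ℚ) ≤
      ((Fintype.card V - 1 : ℕ) : ℚ) / ((l - 2 : ℕ) : ℚ) * ((l - 1).choose s : ℚ) := by
  classical
  obtain ⟨r, rfl⟩ : ∃ r, s = r + 2 := ⟨s - 2, by omega⟩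
  have h := luo_finset G (l - 1) r (by omega)
    (fun v c hc => by have := hG v c hc; omega) _ Finset.univ rfl
  have e : cliqueCount G (r + 2) = (((Finset.univ : Finset V).powersetCard (r + 2)).filter
      (fun T : Finset V => G.IsClique (T : Set V))).card := by
    rw [cliqueCount, ← Set.ncard_coe_finset]
    apply congrArg Set.ncard
    ext T
    simp [SimpleGraph.isNClique_iff, and_comm]
  rw [← e, Finset.card_univ] at h
  have hl2 : l - 1 - 1 = l - 2 := by omega
  rw [hl2] at h
  have hpos : (0 : ℚ) < ((l - 2 : ℕ) : ℚ) := by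
    have : 0 < l - 2 := by omega
    exact_mod_cast this
  rw [div_mul_eq_mul_div, le_div_iff₀ hpos, mul_comm]
  exact_mod_cast h
end

section
/- Let l ≥ 2 and s ≥ 2 be integers. If G is a simple graph on n vertices containing no path with l vertices, then the number of copies of K_s in G satisfies N_s(G) ≤ (n/(l-1))·C(l-1, s). -/
theorem pow_ch (d j : ℕ) : 2^j * d.choose j ≤ (2*d).choose j := by
  induction j with
  | zero => simp
  | succ j ih =>
    have h1 := Nat.choose_succ_right_eq d j
    have h2 := Nat.choose_succ_right_eq (2*d) j
    apply Nat.le_of_mul_le_mul_right (c := j+1) _ (by omega)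
    rw [h2, pow_succ]
    calc 2^j*2*d.choose (j+1) * (j+1) = 2^j*2*(d.choose (j+1) * (j+1)) := by ring
      _ = (2^j * d.choose j) * (2*(d-j)) := by rw [h1]; ring
      _ ≤ _ := Nat.mul_le_mul ih (by omega)

theorem arith1 (k d s : ℕ) (hk : 2*d < k) (hs : 2 ≤ s) : k * d.choose (s-1) ≤ k.choose s := by
  obtain ⟨j, rfl⟩ : ∃ j, s = j+1 := ⟨s-1, by omega⟩
  obtain ⟨k, rfl⟩ : ∃ j, k = j+1 := ⟨k-1, by omega⟩
  have h := Nat.add_one_mul_choose_eq k j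
  simp only [Nat.add_sub_cancel]
  apply Nat.le_of_mul_le_mul_right (c := j+1) _ (by omega)
  rw [← h, mul_assoc]
  apply Nat.mul_le_mul_left
  have h3 := pow_ch d j
  have h4 : j + 1 ≤ 2^j := Nat.lt_two_pow_self
  calc _ ≤ d.choose j * 2^j := Nat.mul_le_mul_left _ h4
    _ = 2^j * d.choose j := mul_comm _ _
    _ ≤ _ := h3
    _ ≤ _ := Nat.choose_le_choose _ (by omega)

theorem arith2 (k m s : ℕ) (hm : m ≤ k) (hs : 2 ≤ s) : k * m.choose s ≤ m * k.choose s := by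
  obtain ⟨j, rfl⟩ : ∃ j, s = j+1 := ⟨s-1, by omega⟩
  rcases m with _ | m
  · simp
  obtain ⟨k, rfl⟩ : ∃ j, k = j+1 := ⟨k-1, by omega⟩
  have h := Nat.add_one_mul_choose_eq k j
  have h' := Nat.add_one_mul_choose_eq m j
  apply Nat.le_of_mul_le_mul_right (c := j+1) _ (by omega)
  rw [mul_assoc, mul_assoc, ← h, ← h']
  have := Nat.choose_le_choose j (show m ≤ k by omega)
  nlinarith [Nat.mul_le_mul_left ((k+1)*(m+1)) this]

open Classical in
noncomputable def cnt {V : Type*} (G : SimpleGraph V) (s : ℕ) (A : Finset V) : ℕ :=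
  ((A.powersetCard s).filter (fun t : Finset V => G.IsClique (t : Set V))).card

open Classical in
theorem cnt_erase {V : Type*} (G : SimpleGraph V) (s : ℕ) (A : Finset V) (v : V) :
    cnt G s A ≤ (A.filter (G.Adj v)).card.choose (s-1) + cnt G s (A.erase v) := by
  unfold cnt
  rw [← Finset.card_powersetCard, ← Finset.card_filter_add_card_filter_not (s := (A.powersetCard s).filter _) (fun t => v ∈ t)]
  apply Nat.add_le_add
  · apply Finset.card_le_card_of_injOn (fun t => t.erase v)
    · intro t ht
      simp only [Finset.coe_filter, Finset.mem_filter, Finset.mem_powersetCard, Set.mem_ofPred_eq, Finset.mem_coe] at ht ⊢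
      obtain ⟨⟨⟨h1, h2⟩, h3⟩, h4⟩ := ht
      refine ⟨fun x hx => ?_, by rw [Finset.card_erase_of_mem h4, h2]⟩
      rw [Finset.mem_erase] at hx
      exact Finset.mem_filter.2 ⟨h1 hx.2, h3 h4 hx.2 hx.1.symm⟩
    · intro t ht t' ht' h
      simp only [Finset.coe_filter, Finset.mem_filter, Set.mem_ofPred_eq] at ht ht' h
      rw [← Finset.insert_erase ht.2, h, Finset.insert_erase ht'.2]
  · apply Finset.card_le_card
    intro t ht
    simp only [Finset.mem_filter, Finset.mem_powersetCard] at ht ⊢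
    obtain ⟨⟨⟨h1, h2⟩, h3⟩, h4⟩ := ht
    exact ⟨⟨Finset.subset_erase.2 ⟨h1, h4⟩, h2⟩, h3⟩

open Classical in
theorem cnt_sdiff {V : Type*} (G : SimpleGraph V) (s : ℕ) (A S : Finset V)
    (h : ∀ x ∈ S, ∀ y ∈ A, G.Adj x y → y ∈ S) :
    cnt G s A ≤ S.card.choose s + cnt G s (A \ S) := by
  unfold cnt
  rw [← Finset.card_powersetCard, ← Finset.card_filter_add_card_filter_not (s := (A.powersetCard s).filter _) (fun t => t ⊆ S)]
  apply Nat.add_le_add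
  · apply Finset.card_le_card
    intro t ht
    simp only [Finset.mem_filter, Finset.mem_powersetCard] at ht ⊢
    exact ⟨ht.2, ht.1.1.2⟩
  · apply Finset.card_le_card
    intro t ht
    simp only [Finset.mem_filter, Finset.mem_powersetCard] at ht ⊢
    obtain ⟨⟨⟨h1, h2⟩, h3⟩, h4⟩ := ht
    refine ⟨⟨fun x hx => Finset.mem_sdiff.2 ⟨h1 hx, fun hxS => h4 fun y hy => ?_⟩, h2⟩, h3⟩
    by_cases e : x = y
    · exact e ▸ hxS
    · exact h x hxS y (h1 hy) (h3 hx hy e)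

/-- rotation -/
theorem rot {V : Type*} (G : SimpleGraph V) (X Y : List V) (hX : X ≠ []) (hY : Y ≠ [])
    (hc : (X ++ Y).IsChain G.Adj) (h1 : G.Adj (X.head hX) (Y.head hY))
    (h2 : G.Adj (X.getLast hX) (Y.getLast hY)) (x : V) (hx : x ∈ X ++ Y) :
    ∃ L : List V, L.IsChain G.Adj ∧ L.Perm (X ++ Y) ∧ L.head? = some x := by
  have hp : (X ++ Y.reverse).Perm (X ++ Y) := List.Perm.append_left _ (List.reverse_perm _)
  have hx' := hp.mem_iff.2 hx
  obtain ⟨P, Q, hPQ⟩ := List.append_of_mem hx'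
  have hsymm : (fun a b => G.Adj b a) = G.Adj := by ext a b; exact G.adj_comm _ _
  have hch : (X ++ Y.reverse).IsChain G.Adj := by
    rw [List.isChain_append] at hc ⊢
    refine ⟨hc.1, ?_, ?_⟩
    · rw [List.isChain_reverse]; 
      have := hc.2.1
      simpa [flip, hsymm] using this
    · intro a ha b hb
      rw [List.getLast?_eq_some_getLast hX] at ha
      rw [List.head?_reverse, List.getLast?_eq_some_getLast hY] at hb
      simp at ha hb
      subst ha hb
      exact h2
  have hcl : ∀ a ∈ (X ++ Y.reverse).getLast?, ∀ b ∈ (X ++ Y.reverse).head?, G.Adj a b := by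
    intro a ha b hb
    have h3 : Y.reverse ≠ [] := by simpa using hY
    rw [List.getLast?_append_of_ne_nil _ h3, List.getLast?_reverse, List.head?_eq_some_head hY] at ha
    rw [List.head?_append_of_ne_nil _ hX, List.head?_eq_some_head hX] at hb
    simp at ha hb
    subst ha hb
    exact h1.symm
  rw [hPQ] at hch hcl
  refine ⟨x :: Q ++ P, ?_, ?_, rfl⟩
  · rw [List.isChain_append] at hch ⊢
    refine ⟨hch.2.1, hch.1, ?_⟩
    intro a ha b hb
    refine hcl a ?_ b ?_
    · rwa [List.getLast?_append_of_ne_nil _ (by simp)]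
    · cases P with
      | nil => simp at hb
      | cons => simpa using hb
  · refine List.Perm.trans ?_ hp
    rw [hPQ]
    exact List.perm_append_comm

theorem toWalk {V : Type*} (G : SimpleGraph V) (L : List V) (hL : L.IsChain G.Adj) (h : L ≠ []) :
    ∃ (u v : V) (p : G.Walk u v), p.support = L := 
  ⟨_, _, SimpleGraph.Walk.ofSupport L h hL, by simp⟩

open Classical in
theorem core {V : Type*} (G : SimpleGraph V) (k : ℕ) (A : Finset V)
    (hA : A.Nonempty) 
    (H : ∀ L : List V, L.IsChain G.Adj → L.Nodup → L.length ≤ k)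
    (hd : ∀ v ∈ A, k ≤ 2 * (A.filter (G.Adj v)).card) :
    ∃ S ⊆ A, S.Nonempty ∧ S.card ≤ k ∧ ∀ x ∈ S, ∀ y ∈ A, G.Adj x y → y ∈ S := by
  let P : ℕ → Prop := fun m => ∃ L : List V, L.IsChain G.Adj ∧ L.Nodup ∧ (∀ x ∈ L, x ∈ A) ∧ L.length = m
  obtain ⟨a, ha⟩ := hA
  have hP1 : P 1 := ⟨[a], by simp, by simp, by simpa using ha, rfl⟩
  have hk1 : 1 ≤ k := H [a] (by simp) (by simp)
  obtain ⟨L, hc, hn, hLA, hlen⟩ := Nat.findGreatest_spec (P := P) hk1 hP1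
  have hpos : 1 ≤ Nat.findGreatest P k := Nat.le_findGreatest hk1 hP1
  have hmax : ∀ L' : List V, L'.IsChain G.Adj → L'.Nodup → (∀ x ∈ L', x ∈ A) → L'.length ≤ L.length := by
    intro L' h1 h2 h3
    rw [hlen]
    exact Nat.le_findGreatest (H L' h1 h2) ⟨L', h1, h2, h3, rfl⟩
  have hmk := H L hc hn
  rw [← hlen] at hpos
  clear_value P
  have hne : L ≠ [] := by rintro rfl; simp at hpos
  -- extension
  have hext : ∀ L' : List V, L'.IsChain G.Adj → L'.Perm L → ∀ x, L'.head? = some x → ∀ y ∈ A, G.Adj x y → y ∈ L := by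
    intro L' h1 h2 x hx y hy hxy
    by_contra hyL
    have := hmax (y :: L') (by
      rw [List.isChain_cons]
      refine ⟨?_, h1⟩
      intro z hz; rw [hx] at hz; simp at hz; subst hz; exact hxy.symm) 
      (by rw [List.nodup_cons]; exact ⟨fun h => hyL (h2.mem_iff.1 h), h2.nodup_iff.2 hn⟩)
      (by
        intro z hz
        rcases List.mem_cons.1 hz with rfl | hz
        · exact hy
        · exact hLA z (h2.mem_iff.1 hz))
    have := h2.length_eq
    simp at *
    omega
  refine ⟨L.toFinset, fun x hx => hLA x (by simpa using hx), ⟨L.head hne, by simp⟩, 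
    (List.toFinset_card_le _).trans hmk, ?_⟩
  have hsymm : (fun a b => G.Adj b a) = G.Adj := by ext a b; exact G.adj_comm _ _
  -- pigeonhole
  set m := L.length with hm
  let I := (Finset.range (m-1)).filter (fun i => ∃ h : i + 1 < L.length, G.Adj (L.head hne) L[i+1])
  let J := (Finset.range (m-1)).filter (fun i => ∃ h : i < L.length, G.Adj (L.getLast hne) L[i])
  have hI : (A.filter (G.Adj (L.head hne))).card ≤ I.card := by
    apply Finset.card_le_card_of_surjOn (fun i => L.getD (i+1) a)
    intro y hy
    simp only [Finset.coe_filter, Set.mem_ofPred_eq] at hy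
    have hyL := hext L hc (List.Perm.refl _) _ (List.head?_eq_some_head hne) y hy.1 hy.2
    obtain ⟨i, hi, rfl⟩ := List.getElem_of_mem hyL
    rcases i with _ | i
    · exfalso
      have := hy.2
      rw [List.head_eq_getElem] at this
      exact G.irrefl this
    · refine ⟨i, ?_, ?_⟩
      · simp only [I, Finset.coe_filter, Set.mem_ofPred_eq, Finset.mem_range]
        exact ⟨by omega, hi, hy.2⟩
      · simp [hi]
  have hJ : (A.filter (G.Adj (L.getLast hne))).card ≤ J.card := by
    apply Finset.card_le_card_of_surjOn (fun i => L.getD i a)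
    intro y hy
    simp only [Finset.coe_filter, Set.mem_ofPred_eq] at hy
    have hyL := hext L.reverse (by rw [List.isChain_reverse]; simpa [flip, hsymm] using hc) (List.reverse_perm _) _ 
      (by rw [List.head?_reverse]; exact List.getLast?_eq_some_getLast hne) y hy.1 hy.2
    obtain ⟨i, hi, rfl⟩ := List.getElem_of_mem hyL
    by_cases him : i = m - 1
    · exfalso
      have := hy.2
      subst him
      rw [List.getLast_eq_getElem] at this
      exact G.irrefl this
    · refine ⟨i, ?_, ?_⟩
      · simp only [J, Finset.coe_filter, Set.mem_ofPred_eq, Finset.mem_range]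
        exact ⟨by omega, hi, hy.2⟩
      · simp [hi]
  have h1 := hd _ (hLA _ (List.head_mem hne))
  have h2 := hd _ (hLA _ (List.getLast_mem hne))
  have hIJ : (I ∩ J).Nonempty := by
    rw [← Finset.card_pos]
    have h3 := Finset.card_union_add_card_inter I J
    have h4 : (I ∪ J).card ≤ m - 1 := by
      rw [← Finset.card_range (m-1)]
      exact Finset.card_le_card (Finset.union_subset (Finset.filter_subset _ _) (Finset.filter_subset _ _))
    omega
  obtain ⟨i, hi⟩ := hIJ
  simp only [I, J, Finset.mem_inter, Finset.mem_filter] at hi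
  obtain ⟨⟨hir, hi1, hI1⟩, _, hi2, hJ1⟩ := hi
  have hsplit : L.take (i+1) ++ L.drop (i+1) = L := List.take_append_drop _ _
  have hX : L.take (i+1) ≠ [] := by simp [hne]
  have hY : L.drop (i+1) ≠ [] := by simp; omega
  intro x hx y hy hxy
  obtain ⟨L', g1, g2, g3⟩ := rot G (L.take (i+1)) (L.drop (i+1)) hX hY (by rwa [hsplit])
    (by simpa [List.head_take, List.head_drop] using hI1)
    (by
      rw [List.getLast_drop, List.getLast_eq_getElem hX]
      have : (List.take (i+1) L).length - 1 = i := by simp; omega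
      simp only [this, List.getElem_take]
      exact hJ1.symm) x (by rw [hsplit]; simpa using hx)
  rw [hsplit] at g2
  simpa using hext L' g1 g2 x g3 y hy hxy

theorem mainCnt {V : Type*} (G : SimpleGraph V) (k s : ℕ) (hs : 2 ≤ s)
    (H : ∀ L : List V, L.IsChain G.Adj → L.Nodup → L.length ≤ k) (A : Finset V) :
    k * cnt G s A ≤ A.card * k.choose s := by
  classical
  induction A using Finset.strongInduction with
  | H A ih =>
  rcases A.eq_empty_or_nonempty with rfl | hA
  · have : cnt G s ∅ = 0 := by
      unfold cnt
      rw [Finset.powersetCard_eq_empty.2 (by simp; omega)]; simp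
    simp [this]
  by_cases hd : ∀ v ∈ A, k ≤ 2 * (A.filter (G.Adj v)).card
  · obtain ⟨S, hSA, hS, hSk, hcl⟩ := core G k A hA H hd
    have h1 := cnt_sdiff G s A S hcl
    have h2 := ih (A \ S) (Finset.sdiff_ssubset hSA hS)
    have h3 := arith2 k S.card s hSk hs
    have h4 := Finset.card_sdiff_add_card_eq_card hSA
    calc k * cnt G s A ≤ k * (S.card.choose s + cnt G s (A \ S)) := Nat.mul_le_mul_left _ h1
      _ ≤ S.card * k.choose s + (A \ S).card * k.choose s := by rw [mul_add]; exact Nat.add_le_add h3 h2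
      _ = _ := by rw [← h4]; ring
  · push Not at hd
    obtain ⟨v, hv, hlt⟩ := hd
    have h1 := cnt_erase G s A v
    have h2 := ih (A.erase v) (Finset.erase_ssubset hv)
    have h3 := arith1 k _ s hlt hs
    have h4 := Finset.card_erase_add_one hv
    refine (Nat.mul_le_mul_left k h1).trans ?_
    rw [← h4, mul_add, add_mul, one_mul, add_comm]
    refine Nat.add_le_add h2 ?_
    convert h3

theorem luo_paths {V : Type*} [Fintype V] (G : SimpleGraph V) (l s : ℕ)
    (hl : 2 ≤ l) (hs : 2 ≤ s)
    (hG : ¬ ∃ (u v : V) (p : G.Walk u v), p.IsPath ∧ p.length + 1 = l) :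
    (cliqueCount G s : ℚ) ≤
      (Fintype.card V : ℚ) / ((l - 1 : ℕ) : ℚ) * ((l - 1).choose s : ℚ) := by
  classical
  have H : ∀ L : List V, L.IsChain G.Adj → L.Nodup → L.length ≤ l - 1 := by
    intro L hc hn
    by_contra hlt
    have hc' : (L.take l).IsChain G.Adj := hc.take _
    have hn' : (L.take l).Nodup := hn.sublist (List.take_sublist _ _)
    have hlen : (L.take l).length = l := by simp; omega
    obtain ⟨u, v, p, hp⟩ := toWalk G (L.take l) hc' (by intro h; rw [h] at hlen; simp at hlen; omega)
    refine hG ⟨u, v, p, ?_, ?_⟩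
    · rw [SimpleGraph.Walk.isPath_def, hp]; exact hn'
    · rw [← SimpleGraph.Walk.length_support, hp, hlen]
  have h := mainCnt G (l-1) s hs H Finset.univ
  have he : cliqueCount G s = cnt G s Finset.univ := by
    unfold cliqueCount cnt
    rw [← Set.ncard_coe_finset]
    congr 1
    ext t
    simp [SimpleGraph.isNClique_iff, Finset.mem_powersetCard, and_comm]
  rw [he, div_mul_eq_mul_div, le_div_iff₀ (by exact_mod_cast (by omega : 0 < l - 1)), mul_comm]
  exact_mod_cast h
end

section
/- Let G be a simple graph on n vertices containing no cycle of length at least l, where l ≥ 3. Then for every integer k with 3 ≤ k ≤ ω(G), the clique counts of G satisfy k·N_k(G) ≤ (l-k)·N_{k-1}(G). -/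
open Classical in
/-- ordered clique count inside S -/
noncomputable def ordCl {V : Type*} (G : SimpleGraph V) : ℕ → Finset V → ℕ
  | 0, _ => 1
  | j + 1, S => ∑ v ∈ S, ordCl G j (S.filter (G.Adj v))

/-- all paths within S have at most t vertices -/
def PathBd {V : Type*} (G : SimpleGraph V) (S : Finset V) (t : ℕ) : Prop :=
  ∀ p : List V, p.IsChain G.Adj → p.Nodup → (∀ x ∈ p, x ∈ S) → p.length ≤ t

theorem rot_aux {V : Type*} (G : SimpleGraph V) (c : List V) (hc : c.IsChain G.Adj)
    (hcl : ∀ x ∈ c.getLast?, ∀ y ∈ c.head?, G.Adj x y) (a : V) (ha : a ∈ c) :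
    ∃ d : List V, (a :: d).IsChain G.Adj ∧ (a :: d).Perm c := by
  obtain ⟨c1, c2, rfl⟩ := List.append_of_mem ha
  refine ⟨c2 ++ c1, ?_, ?_⟩
  · rw [← List.cons_append]
    rw [List.isChain_append] at hc ⊢
    refine ⟨hc.2.1, hc.1, ?_⟩
    intro x hx y hy
    apply hcl x _ y
    · rw [List.head?_append]; simp at hy ⊢; simp [hy]
    · rw [List.getLast?_append]; simp at hx ⊢; simp [hx]
  · rw [← List.cons_append]; exact List.perm_append_comm

theorem posa_aux {V : Type*} (G : SimpleGraph V) (p : List V) (hp : p.IsChain G.Adj)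
    (i : ℕ) (hi : i + 1 < p.length) (h0 : G.Adj p[0] p[i+1])
    (h1 : G.Adj p[i] (p[p.length - 1])) :
    ∃ c : List V, c.IsChain G.Adj ∧ c.Perm p ∧
      (∀ x ∈ c.getLast?, ∀ y ∈ c.head?, G.Adj x y) := by
  have hp' := hp
  rw [← List.take_append_drop (i+1) p, List.isChain_append] at hp'
  have hne : p ≠ [] := by rintro rfl; simp at hi
  have e1 : (p.drop (i+1)).getLast? = some p[p.length - 1] := by
    rw [List.getLast?_drop, if_neg (by omega), List.getLast?_eq_getElem?]; simp
  have e2 : (p.take (i+1)).getLast? = some p[i] := by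
    rw [List.getLast?_take]; simp [List.getElem?_eq_getElem (show i < p.length by omega)]
  have e3 : (p.drop (i+1)).head? = some p[i+1] := by
    rw [List.head?_drop]; simp [hi]
  have e4 : (p.take (i+1)).head? = some p[0] := by
    rw [List.head?_take]; simp [List.head?_eq_getElem?]
  refine ⟨p.drop (i+1) ++ (p.take (i+1)).reverse, ?_, ?_, ?_⟩
  · rw [List.isChain_append]
    refine ⟨hp'.2.1, ?_, ?_⟩
    · rw [List.isChain_reverse]
      exact hp'.1.imp (fun a b h => h.symm)
    · rw [List.head?_reverse, e1, e2]
      simpa using h1.symm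
  · refine List.perm_append_comm.trans ?_
    refine ((List.reverse_perm _).append_right _).trans ?_
    rw [List.take_append_drop]
  · rw [List.getLast?_append, List.getLast?_reverse, List.head?_append, e3, e4]
    simpa using h0

open Classical in
theorem closed_aux {V : Type*} (G : SimpleGraph V) (S : Finset V) (t : ℕ) (hS : S.Nonempty)
    (hb : PathBd G S t) (hd : ∀ v ∈ S, t ≤ 2 * (S.filter (G.Adj v)).card) :
    ∃ A : Finset V, A.Nonempty ∧ A ⊆ S ∧ A.card ≤ t ∧ ∀ a ∈ A, ∀ b ∈ S, G.Adj a b → b ∈ A := by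
  obtain ⟨p, ⟨hp, hn, hs⟩, hmax⟩ : ∃ p : List V, (p.IsChain G.Adj ∧ p.Nodup ∧ (∀ x ∈ p, x ∈ S)) ∧
      ∀ q : List V, q.IsChain G.Adj → q.Nodup → (∀ x ∈ q, x ∈ S) → q.length ≤ p.length := by
    let P : ℕ → Prop := fun m => ∃ p : List V, (p.IsChain G.Adj ∧ p.Nodup ∧ (∀ x ∈ p, x ∈ S)) ∧
      p.length = m
    have hP : P 0 := ⟨[], by simp⟩
    obtain ⟨p, hp, hl⟩ : P (Nat.findGreatest P t) := Nat.findGreatest_spec (Nat.zero_le t) hP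
    refine ⟨p, hp, fun q h1 h2 h3 => ?_⟩
    rw [hl]
    exact Nat.le_findGreatest (hb q h1 h2 h3) ⟨q, ⟨h1, h2, h3⟩, rfl⟩
  have hpos : 0 < p.length := by
    obtain ⟨x, hx⟩ := hS
    have := hmax [x] (by simp) (by simp) (by simpa using hx)
    simp only [List.length_singleton] at this
    omega
  have hpt := hb p hp hn hs
  have hfirst : ∀ b ∈ S, G.Adj p[0] b → b ∈ p := by
    intro b hbS hadj
    by_contra hbp
    have := hmax (b :: p) (by
      rw [List.isChain_cons]
      refine ⟨?_, hp⟩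
      intro y hy
      rw [List.head?_eq_getElem?, List.getElem?_eq_getElem hpos] at hy
      simp at hy; subst hy; exact hadj.symm) (by simp [hbp, hn]) (by simpa [hbS] using hs)
    simp at this
  have hlast : ∀ b ∈ S, G.Adj p[p.length - 1] b → b ∈ p := by
    intro b hbS hadj
    by_contra hbp
    have := hmax (p ++ [b]) (by
      rw [List.isChain_append]
      refine ⟨hp, by simp, ?_⟩
      intro y hy
      rw [List.getLast?_eq_getElem?, List.getElem?_eq_getElem (by omega)] at hy
      simp at hy; subst hy; simpa using hadj)
      (by
        rw [List.nodup_append]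
        refine ⟨hn, by simp, ?_⟩
        rintro a ha b' hb' rfl
        simp at hb'; subst hb'; exact hbp ha)
      (by
        intro x hx
        simp at hx
        rcases hx with hx | rfl
        · exact hs x hx
        · exact hbS)
    simp at this
  let g : ℕ → V := fun i => p.getD i p[0]
  have hg : ∀ i (h : i < p.length), g i = p[i] := by
    intro i h; simp [g, h]
  let I := (Finset.range (p.length - 1)).filter (fun i => G.Adj p[0] (g (i+1)))
  let J := (Finset.range (p.length - 1)).filter (fun i => G.Adj p[p.length - 1] (g i))
  have hI : (S.filter (G.Adj p[0])).card ≤ I.card := by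
    refine (Finset.card_le_card ?_).trans (Finset.card_image_le (f := fun i => g (i+1)))
    intro b hb'
    rw [Finset.mem_filter] at hb'
    obtain ⟨i, hi, rfl⟩ := List.getElem_of_mem (hfirst b hb'.1 hb'.2)
    rcases i with _ | i
    · exact absurd hb'.2 (G.loopless.irrefl _)
    · refine Finset.mem_image.2 ⟨i, ?_, hg _ hi⟩
      refine Finset.mem_filter.2 ⟨Finset.mem_range.2 (by omega), ?_⟩
      rw [hg _ hi]; exact hb'.2
  have hJ : (S.filter (G.Adj p[p.length - 1])).card ≤ J.card := by
    refine (Finset.card_le_card ?_).trans (Finset.card_image_le (f := fun i => g i))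
    intro b hb'
    rw [Finset.mem_filter] at hb'
    obtain ⟨i, hi, rfl⟩ := List.getElem_of_mem (hlast b hb'.1 hb'.2)
    by_cases h : i = p.length - 1
    · subst h; exact absurd hb'.2 (G.loopless.irrefl _)
    · refine Finset.mem_image.2 ⟨i, ?_, hg _ hi⟩
      refine Finset.mem_filter.2 ⟨Finset.mem_range.2 (by omega), ?_⟩
      rw [hg _ hi]; exact hb'.2
  have d1 := hd p[0] (hs _ (List.getElem_mem _))
  have d2 := hd p[p.length - 1] (hs _ (List.getElem_mem _))
  have hU : (I ∪ J).card ≤ p.length - 1 := by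
    have := Finset.card_le_card (show I ∪ J ⊆ Finset.range (p.length - 1) from
      Finset.union_subset (Finset.filter_subset _ _) (Finset.filter_subset _ _))
    simpa using this
  have hIJ := Finset.card_union_add_card_inter I J
  have : 0 < (I ∩ J).card := by omega
  obtain ⟨i, hi⟩ := Finset.card_pos.1 this
  rw [Finset.mem_inter, Finset.mem_filter, Finset.mem_filter, Finset.mem_range] at hi
  obtain ⟨⟨hi, h0⟩, -, h1⟩ := hi
  have hi' : i + 1 < p.length := by omega
  rw [hg _ hi'] at h0
  rw [hg i (by omega)] at h1
  obtain ⟨c, hc, hcp, hcl⟩ := posa_aux G p hp i hi' h0 h1.symm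
  refine ⟨p.toFinset, ⟨p[0], by simp⟩, ?_, ?_, ?_⟩
  · intro x hx; exact hs x (by simpa using hx)
  · exact (List.toFinset_card_le p).trans hpt
  · intro a ha b hbS hadj
    rw [List.mem_toFinset] at ha ⊢
    obtain ⟨d, hd1, hd2⟩ := rot_aux G c hc hcl a (hcp.mem_iff.2 ha)
    have hdp := hd2.trans hcp
    by_contra hbp
    have := hmax (b :: a :: d) (by
      rw [List.isChain_cons_cons]; exact ⟨hadj.symm, hd1⟩) (by
        rw [List.nodup_cons]
        exact ⟨fun h => hbp (hdp.mem_iff.1 h), hdp.nodup_iff.2 hn⟩) (by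
        intro x hx
        rcases List.mem_cons.1 hx with rfl | hx
        · exact hbS
        · exact hs _ (hdp.mem_iff.1 hx))
    rw [List.length_cons, hdp.length_eq] at this
    omega

theorem PathBd.mono {V : Type*} {G : SimpleGraph V} {S T : Finset V} {t : ℕ} (h : PathBd G S t)
    (hT : T ⊆ S) : PathBd G T t := fun p h1 h2 h3 => h p h1 h2 (fun x hx => hT (h3 x hx))

open Classical in
theorem eg_aux {V : Type*} (G : SimpleGraph V) (t : ℕ) (S : Finset V) :
    PathBd G S t → ∑ v ∈ S, (S.filter (G.Adj v)).card ≤ (t - 1) * S.card := by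
  induction S using Finset.strongInduction with
  | H S ih =>
  intro hb
  rcases S.eq_empty_or_nonempty with rfl | hS
  · simp
  by_cases hd : ∀ v ∈ S, t ≤ 2 * (S.filter (G.Adj v)).card
  · obtain ⟨A, hA, hAS, hAt, hcl⟩ := closed_aux G S t hS hb hd
    have h1 := ih (S \ A) (Finset.sdiff_ssubset hAS hA) (hb.mono Finset.sdiff_subset)
    rw [← Finset.sum_sdiff hAS, ← Finset.card_sdiff_add_card_eq_card hAS, mul_add]
    refine add_le_add ?_ ?_
    · refine le_trans (Finset.sum_le_sum ?_) h1
      intro v hv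
      apply Finset.card_le_card
      intro w hw
      simp only [Finset.mem_filter, Finset.mem_sdiff] at hv hw ⊢
      exact ⟨⟨hw.1, fun hwA => hv.2 (hcl w hwA v hv.1 hw.2.symm)⟩, hw.2⟩
    · rw [mul_comm, ← smul_eq_mul]
      apply Finset.sum_le_card_nsmul
      intro v hv
      have : S.filter (G.Adj v) ⊆ A.erase v := by
        intro w hw
        rw [Finset.mem_filter] at hw
        exact Finset.mem_erase.2 ⟨hw.2.ne', hcl v hv w hw.1 hw.2⟩
      have := Finset.card_le_card this
      rw [Finset.card_erase_of_mem hv] at this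
      omega
  · push Not at hd
    obtain ⟨v, hv, hlt⟩ := hd
    have h1 := ih (S.erase v) (Finset.erase_ssubset hv) (hb.mono (Finset.erase_subset _ _))
    have h2 : ∑ w ∈ S.erase v, (S.filter (G.Adj w)).card =
        ∑ w ∈ S.erase v, ((S.erase v).filter (G.Adj w)).card + (S.filter (G.Adj v)).card := by
      have : (S.filter (G.Adj v)).card = ∑ w ∈ S.erase v, if G.Adj v w then 1 else 0 := by
        rw [← Finset.card_filter]
        congr 1
        ext w
        simp only [Finset.mem_filter, Finset.mem_erase]
        exact ⟨fun h => ⟨⟨h.2.ne', h.1⟩, h.2⟩, fun h => ⟨h.1.2, h.2⟩⟩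
      rw [this, ← Finset.sum_add_distrib]
      refine Finset.sum_congr rfl fun w hw => ?_
      rw [Finset.filter_erase]
      by_cases h : G.Adj v w
      · rw [if_pos h, Finset.card_erase_add_one]
        exact Finset.mem_filter.2 ⟨hv, h.symm⟩
      · rw [if_neg h, Finset.erase_eq_of_notMem, add_zero]
        simp only [Finset.mem_filter, not_and]
        exact fun _ h' => h h'.symm
    rw [← Finset.add_sum_erase _ _ hv, h2]
    have h3 := Finset.card_erase_add_one hv
    rw [← h3, mul_add]
    omega

theorem path_ratio {V : Type*} (G : SimpleGraph V) (j : ℕ) : ∀ (t : ℕ) (S : Finset V),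
    PathBd G S t → ordCl G (j + 2) S ≤ (t - (j + 1)) * ordCl G (j + 1) S := by
  classical
  induction j with
  | zero =>
    intro t S h
    have := eg_aux G t S h
    simp only [ordCl, Finset.sum_const, smul_eq_mul, mul_one]
    convert this
  | succ j ih =>
    intro t S h
    rw [ordCl, ordCl, Finset.mul_sum]
    refine Finset.sum_le_sum fun v hv => ?_
    have := ih (t - 1) (S.filter (G.Adj v)) (by
      intro p h1 h2 h3
      have := h (v :: p) (by
        rw [List.isChain_cons]
        refine ⟨fun y hy => ?_, h1⟩
        exact (Finset.mem_filter.1 (h3 y (List.mem_of_mem_head? hy))).2) (by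
          rw [List.nodup_cons]
          exact ⟨fun h => G.loopless.irrefl _ (Finset.mem_filter.1 (h3 v h)).2, h2⟩) (by
          intro x hx
          rcases List.mem_cons.1 hx with rfl | hx
          · exact hv
          · exact (Finset.mem_filter.1 (h3 x hx)).1)
      rw [List.length_cons] at this
      omega)
    rw [show t - 1 - (j + 1) = t - (j + 1 + 1) by omega] at this
    convert this

open Classical in
theorem ordCl_eq {V : Type*} (G : SimpleGraph V) (j : ℕ) : ∀ S : Finset V,
    ordCl G j S = j.factorial * ((S.powersetCard j).filter (fun s : Finset V => G.IsClique (s : Set V))).card := by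
  induction j with
  | zero => intro S; simp [ordCl, Finset.filter_singleton]
  | succ j ih =>
    intro S
    rw [ordCl, Nat.factorial_succ]
    have key : ∑ v ∈ S, (((S.filter (G.Adj v)).powersetCard j).filter
        (fun s : Finset V => G.IsClique (s : Set V))).card =
        (j + 1) * ((S.powersetCard (j+1)).filter (fun s : Finset V => G.IsClique (s : Set V))).card := by
      set C := (S.powersetCard (j+1)).filter (fun s : Finset V => G.IsClique (s : Set V)) with hC
      have h1 : (j + 1) * C.card = ∑ s ∈ C, ∑ v ∈ S, if v ∈ s then 1 else 0 := by
        rw [mul_comm, ← smul_eq_mul, ← Finset.sum_const]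
        refine Finset.sum_congr rfl fun s hs => ?_
        rw [hC, Finset.mem_filter, Finset.mem_powersetCard] at hs
        rw [← Finset.card_filter, Finset.filter_mem_eq_inter, Finset.inter_eq_right.2 hs.1.1, hs.1.2]
      rw [h1, Finset.sum_comm]
      refine Finset.sum_congr rfl fun v hv => ?_
      rw [← Finset.card_filter]
      refine Finset.card_bij' (fun s _ => insert v s) (fun s _ => s.erase v) ?_ ?_ ?_ ?_
      · intro s hs
        simp only [hC, Finset.mem_filter, Finset.mem_powersetCard] at hs ⊢
        obtain ⟨⟨h1, h2⟩, h3⟩ := hs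
        have hvs : v ∉ s := fun h => G.loopless.irrefl _ (Finset.mem_filter.1 (h1 h)).2
        refine ⟨⟨⟨?_, ?_⟩, ?_⟩, Finset.mem_insert_self _ _⟩
        · exact Finset.insert_subset hv (h1.trans (Finset.filter_subset _ _))
        · rw [Finset.card_insert_of_notMem hvs, h2]
        · rw [Finset.coe_insert]
          exact h3.insert fun b hb _ => (Finset.mem_filter.1 (h1 hb)).2
      · intro s hs
        simp only [hC, Finset.mem_filter, Finset.mem_powersetCard] at hs ⊢
        obtain ⟨⟨⟨h1, h2⟩, h3⟩, h4⟩ := hs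
        refine ⟨⟨?_, ?_⟩, ?_⟩
        · intro w hw
          rw [Finset.mem_erase] at hw
          exact Finset.mem_filter.2 ⟨h1 hw.2, h3 h4 hw.2 hw.1.symm⟩
        · rw [Finset.card_erase_of_mem h4, h2]; rfl
        · exact h3.subset (by simp)
      · intro s hs
        simp only [Finset.mem_filter, Finset.mem_powersetCard] at hs
        have hvs : v ∉ s := fun h => G.loopless.irrefl _ (Finset.mem_filter.1 (hs.1.1 h)).2
        exact Finset.erase_insert hvs
      · intro s hs
        simp only [Finset.mem_filter] at hs
        exact Finset.insert_erase hs.2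
    rw [mul_comm (j + 1), mul_assoc, ← key, Finset.mul_sum]
    refine Finset.sum_congr rfl fun v _ => ?_
    rw [ih]

theorem ordCl_univ {V : Type*} [Fintype V] (G : SimpleGraph V) (j : ℕ) :
    ordCl G j Finset.univ = j.factorial * cliqueCount G j := by
  classical
  rw [ordCl_eq, cliqueCount, ← Set.ncard_coe_finset]
  congr 2
  ext s
  simp [SimpleGraph.isNClique_iff, and_comm]

theorem walk_of_list {V : Type*} (G : SimpleGraph V) : ∀ (p : List V) (v : V),
    (v :: p).IsChain G.Adj → ∃ (w : V) (q : G.Walk v w), q.support = v :: p := by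
  intro p
  induction p with
  | nil => intro v _; exact ⟨v, .nil, by simp⟩
  | cons a p ih =>
    intro v h
    rw [List.isChain_cons_cons] at h
    obtain ⟨w, q, hq⟩ := ih a h.2
    exact ⟨w, .cons h.1 q, by simp [hq]⟩

open Classical in
theorem link_bd {V : Type*} [Fintype V] (G : SimpleGraph V)
    (l : ℕ) (hl : 3 ≤ l)
    (hG : ∀ (v : V) (c : G.Walk v v), c.IsCycle → c.length < l) (v : V) :
    PathBd G (Finset.univ.filter (G.Adj v)) (l - 2) := by
  intro p h1 h2 h3
  rcases p with _ | ⟨a, p⟩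
  · simp
  rcases p with _ | ⟨b, p⟩
  · simp; omega
  obtain ⟨w, q, hq⟩ := walk_of_list G _ _ h1
  have hqp : q.IsPath := by rw [SimpleGraph.Walk.isPath_def, hq]; exact h2
  have hadj : ∀ x ∈ q.support, G.Adj v x := fun x hx => by
    rw [hq] at hx; exact (Finset.mem_filter.1 (h3 x hx)).2
  have hva := hadj a q.start_mem_support
  have hvw := hadj w q.end_mem_support
  have hvn : v ∉ q.support := fun h => G.loopless.irrefl _ (hadj v h)
  have hlen : q.length + 1 = p.length + 2 := by
    rw [← SimpleGraph.Walk.length_support, hq]; simp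
  have haw : a ≠ w := by
    rintro rfl
    have := SimpleGraph.Walk.isPath_iff_nil.1 hqp
    rw [SimpleGraph.Walk.nil_iff_length_eq] at this
    omega
  have hc : (SimpleGraph.Walk.cons hvw.symm (SimpleGraph.Walk.cons hva q)).IsCycle := by
    rw [SimpleGraph.Walk.cons_isCycle_iff]
    refine ⟨?_, ?_⟩
    · rw [SimpleGraph.Walk.cons_isPath_iff]; exact ⟨hqp, hvn⟩
    · rw [SimpleGraph.Walk.edges_cons, List.mem_cons, not_or]
      refine ⟨?_, fun h => hvn (q.snd_mem_support_of_mem_edges h)⟩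
      intro h
      rw [Sym2.eq_iff] at h
      rcases h with h | h
      · exact hvw.ne h.1.symm
      · exact haw h.1.symm
  have := hG _ _ hc
  simp only [SimpleGraph.Walk.length_cons] at this
  simp only [List.length_cons]
  omega

/-- If `G` has no cycle of length at least `l` (where `l ≥ 3`), then for every
`k` with `3 ≤ k ≤ ω(G)` one has `k·N_k(G) ≤ (l-k)·N_{k-1}(G)`. -/
theorem cliqueCount_ratio_of_no_long_cycle {V : Type*} [Fintype V] (G : SimpleGraph V)
    (l : ℕ) (hl : 3 ≤ l)
    (hG : ∀ (v : V) (c : G.Walk v v), c.IsCycle → c.length < l)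
    (k : ℕ) (hk3 : 3 ≤ k) (hkω : k ≤ G.cliqueNum) :
    (k : ℤ) * cliqueCount G k ≤ ((l : ℤ) - k) * cliqueCount G (k - 1) := by
  classical
  obtain ⟨j, rfl⟩ := Nat.exists_eq_add_of_le' hk3
  have h1 : ordCl G (j + 3) Finset.univ ≤ (l - (j + 3)) * ordCl G (j + 2) Finset.univ := by
    rw [ordCl, ordCl, Finset.mul_sum]
    refine Finset.sum_le_sum fun v _ => ?_
    have := path_ratio G j _ _ (link_bd G l hl hG v)
    rw [show l - 2 - (j + 1) = l - (j + 3) by omega] at this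
    convert this
  rw [ordCl_univ, ordCl_univ, Nat.factorial_succ] at h1
  have h2 : (j + 3) * cliqueCount G (j + 3) ≤ (l - (j + 3)) * cliqueCount G (j + 2) := by
    refine Nat.le_of_mul_le_mul_left ?_ (Nat.factorial_pos (j + 2))
    calc _ = (j + 2 + 1) * (j + 2).factorial * cliqueCount G (j + 3) := by ring
      _ ≤ _ := h1
      _ = _ := by ring
  have h3 : 0 < cliqueCount G (j + 3) := by
    obtain ⟨s, hs⟩ := G.exists_isNClique_cliqueNum
    obtain ⟨u, hu, hc⟩ := Finset.exists_subset_card_eq (hs.card_eq.symm ▸ hkω)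
    rw [cliqueCount, Set.ncard_pos (Set.toFinite _)]
    exact ⟨u, hs.isClique.subset (by exact_mod_cast hu), hc⟩
  have h4 : j + 3 ≤ l := by
    by_contra h
    rw [Nat.sub_eq_zero_of_le (by omega), zero_mul] at h2
    have : 0 < (j + 3) * cliqueCount G (j + 3) := by positivity
    omega
  rw [show j + 3 - 1 = j + 2 by omega, ← Nat.cast_sub h4]
  exact_mod_cast h2
end

section
/- Let n ≥ c ≥ 5 be integers. If G is a 2-connected simple graph on n vertices whose circumference (length of a longest cycle) is less than c, then the number of edges of G satisfies N_2(G) ≤ max{ f_2(n,2,c), f_2(n,⌊(c-1)/2⌋,c) }. -/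
/-- `f s n k c = f_s(n,k,c) = C(c-k, s) + (n-(c-k))·C(k, s-1)`, the number of copies of
`K_s` in the graph `H(n,k,c)`. -/
def f (s n k c : ℕ) : ℕ :=
  Nat.choose (c - k) s + (n - (c - k)) * Nat.choose k (s - 1)

/-- A graph is 2-connected if it has at least 3 vertices, is connected, and deleting
any single vertex leaves a connected graph. -/
def TwoConnected {V : Type*} [Fintype V] (G : SimpleGraph V) : Prop :=
  3 ≤ Fintype.card V ∧ G.Connected ∧ ∀ v : V, (G.induce ({v}ᶜ : Set V)).Connected

inductive PathOn {V : Type*} [DecidableEq V] (G : SimpleGraph V) : V → V → Finset V → Prop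
  | single (u : V) : PathOn G u u {u}
  | cons {u v w : V} {S : Finset V} (h : G.Adj u v) (hp : PathOn G v w S) (hu : u ∉ S) :
      PathOn G u w (insert u S)

namespace PathOn

variable {V : Type*} [DecidableEq V] {G : SimpleGraph V}

lemma left_mem {u v : V} {S : Finset V} (h : PathOn G u v S) : u ∈ S := by
  cases h <;> simp

lemma right_mem {u v : V} {S : Finset V} (h : PathOn G u v S) : v ∈ S := by
  induction h with
  | single u => simp
  | cons h hp hu ih => simp [ih]

lemma self_eq {u v : V} {S : Finset V} (h : PathOn G u v S) (e : u = v) : S = {u} := by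
  cases h with
  | single u => rfl
  | cons h hp hu => exact absurd (e ▸ hp.right_mem) hu

lemma append {u v x y : V} {S T : Finset V} (h : PathOn G u v S) (h2 : PathOn G x y T)
    (ha : G.Adj v x) (hd : Disjoint S T) : PathOn G u y (S ∪ T) := by
  induction h with
  | single u =>
    rw [← Finset.insert_eq]
    exact cons ha h2 (by simpa using hd)
  | cons h hp hu ih =>
    rw [Finset.disjoint_insert_left] at hd
    rw [Finset.insert_union]
    exact cons h (ih ha hd.2) (by simp [hu, hd.1])

lemma symm {u v : V} {S : Finset V} (h : PathOn G u v S) : PathOn G v u S := by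
  induction h with
  | single u => exact single u
  | @cons u v w S h hp hu ih =>
    have := ih.append (single u) h.symm (by simpa using hu)
    rwa [Finset.union_comm, ← Finset.insert_eq] at this

lemma snoc {u v x : V} {S : Finset V} (h : PathOn G u v S) (ha : G.Adj v x) (hx : x ∉ S) :
    PathOn G u x (insert x S) := (cons ha.symm h.symm hx).symm

lemma join {u v y : V} {S T : Finset V} (h : PathOn G u v S) (h2 : PathOn G v y T)
    (hd : ∀ z, z ∈ S → z ∈ T → z = v) : PathOn G u y (S ∪ T) := by
  induction h with
  | single u =>
    rw [← Finset.insert_eq, Finset.insert_eq_of_mem h2.left_mem]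
    exact h2
  | @cons u v w S h hp hu ih =>
    rw [Finset.insert_union]
    refine cons h (ih h2 fun z hz hz' => hd z (by simp [hz]) hz') ?_
    rw [Finset.mem_union, not_or]
    refine ⟨hu, fun hT => hu ?_⟩
    rw [hd u (by simp) hT]
    exact hp.right_mem

lemma split {u v w : V} {S : Finset V} (h : PathOn G u v S) (hw : w ∈ S) :
    ∃ S1 S2, PathOn G u w S1 ∧ PathOn G w v S2 ∧ S1 ⊆ S ∧ S2 ⊆ S ∧
      ∀ z, z ∈ S1 → z ∈ S2 → z = w := by
  induction h with
  | single u =>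
    simp only [Finset.mem_singleton] at hw
    subst hw
    exact ⟨{w}, {w}, single w, single w, by simp, by simp, by simp⟩
  | @cons u v x S h hp hu ih =>
    by_cases e : w = u
    · subst e
      exact ⟨{w}, insert w S, single w, cons h hp hu, by simp, by simp, by simp⟩
    · have hw' : w ∈ S := by simpa [e] using hw
      obtain ⟨S1, S2, h1, h2, hs1, hs2, hd⟩ := ih hw'
      refine ⟨insert u S1, S2, cons h h1 (fun h => hu (hs1 h)), h2, by grind, by grind, ?_⟩
      intro z hz hz2
      rcases Finset.mem_insert.1 hz with rfl | hz
      · exact absurd (hs2 hz2) hu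
      · exact hd z hz hz2

lemma card_pos {u v : V} {S : Finset V} (h : PathOn G u v S) : 0 < S.card :=
  Finset.card_pos.2 ⟨u, h.left_mem⟩

lemma toWalk {u v : V} {S : Finset V} (h : PathOn G u v S) :
    ∃ p : G.Walk u v, p.IsPath ∧ p.length + 1 = S.card ∧ ∀ z, z ∈ p.support → z ∈ S := by
  induction h with
  | single u => exact ⟨.nil, by simp, by simp, by simp⟩
  | @cons u v x S h hp hu ih =>
    obtain ⟨p, h1, h2, h3⟩ := ih
    refine ⟨.cons h p, ?_, ?_, ?_⟩
    · rw [SimpleGraph.Walk.cons_isPath_iff]; exact ⟨h1, fun h => hu (h3 _ h)⟩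
    · simp [Finset.card_insert_of_notMem hu, h2]
    · intro z hz
      simp at hz
      rcases hz with rfl | hz
      · simp
      · simp [h3 _ hz]

lemma cycle {u v : V} {S : Finset V} (h : PathOn G u v S) (ha : G.Adj u v) (hS : 3 ≤ S.card) :
    ∃ w : G.Walk v v, w.IsCycle ∧ w.length = S.card := by
  obtain ⟨p, h1, h2, h3⟩ := h.toWalk
  refine ⟨.cons ha.symm p, ?_, by simpa using h2⟩
  rw [SimpleGraph.Walk.cons_isCycle_iff]
  refine ⟨h1, fun he => ?_⟩
  cases p with
  | nil => exact ha.ne rfl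
  | @cons _ x _ hux q =>
    rw [SimpleGraph.Walk.cons_isPath_iff] at h1
    rw [SimpleGraph.Walk.edges_cons, List.mem_cons] at he
    rcases he with he | he
    · have : v = x := by
        have := ha.ne
        simp at he
        grind
      subst this
      have := (SimpleGraph.Walk.isPath_iff_nil.1 h1.1).eq_nil
      subst this
      simp at h2; omega
    · exact h1.2 (SimpleGraph.Walk.snd_mem_support_of_mem_edges q he)

lemma toFun {u v : V} {S : Finset V} (h : PathOn G u v S) :
    ∃ (m : ℕ) (p : ℕ → V), p 0 = u ∧ p m = v ∧ S = (Finset.range (m+1)).image p ∧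
      (∀ i j, i ≤ m → j ≤ m → p i = p j → i = j) ∧ ∀ i, i < m → G.Adj (p i) (p (i+1)) := by
  induction h with
  | single u => exact ⟨0, fun _ => u, rfl, rfl, by simp, by grind, by grind⟩
  | @cons u v x S h hp hu ih =>
    obtain ⟨m, p, h0, hm, hS, hi, ha⟩ := ih
    refine ⟨m+1, fun i => Nat.casesOn i u p, rfl, hm, ?_, ?_, ?_⟩
    · rw [hS]; ext z; simp only [Finset.mem_insert, Finset.mem_image, Finset.mem_range]; constructor
      · rintro (rfl | ⟨i, hi, rfl⟩)
        · exact ⟨0, by omega, rfl⟩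
        · exact ⟨i+1, by omega, rfl⟩
      · rintro ⟨_ | i, hi, rfl⟩
        · exact .inl rfl
        · exact .inr ⟨i, by omega, rfl⟩
    · rintro (_ | i) (_ | j) h1 h2 h3
      · rfl
      · exact absurd (by rw [hS]; exact Finset.mem_image.2 ⟨j, by simp; omega, h3.symm⟩) hu
      · exact absurd (by rw [hS]; exact Finset.mem_image.2 ⟨i, by simp; omega, h3⟩) hu
      · simp at h3; rw [hi i j (by omega) (by omega) h3]
    · rintro (_ | i) h1
      · simpa [h0] using h
      · exact ha i (by omega)

lemma seg {m : ℕ} {p : ℕ → V} (hi : ∀ i j, i ≤ m → j ≤ m → p i = p j → i = j)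
    (ha : ∀ i, i < m → G.Adj (p i) (p (i+1))) (i j : ℕ) (hij : i ≤ j) (hj : j ≤ m) :
    PathOn G (p i) (p j) ((Finset.Icc i j).image p) := by
  induction j, hij using Nat.le_induction with
  | base => simpa using single (G := G) (p i)
  | succ j hij ih =>
    have := (ih (by omega)).snoc (ha j (by omega)) (by
      rw [Finset.mem_image]; rintro ⟨l, hl, he⟩
      have := hi _ _ (by grind) (by grind) he
      grind)
    convert this using 1
    ext z; simp only [Finset.mem_image, Finset.mem_insert, Finset.mem_Icc]
    constructor
    · rintro ⟨l, hl, rfl⟩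
      by_cases e : l = j+1
      · simp [e]
      · exact .inr ⟨l, by omega, rfl⟩
    · rintro (rfl | ⟨l, hl, rfl⟩)
      · exact ⟨j+1, by omega, rfl⟩
      · exact ⟨l, by omega, rfl⟩

lemma ofWalk {u v z : V} (w : G.Walk u v) (hz : z ∉ w.support) :
    ∃ Q, PathOn G u v Q ∧ z ∉ Q := by
  induction w with
  | nil => exact ⟨_, single _, by simpa using hz⟩
  | @cons u v x h q ih =>
    simp at hz
    obtain ⟨Q, h1, h2⟩ := ih hz.2
    by_cases hu : u ∈ Q
    · obtain ⟨S1, S2, _, h3, _, h4, _⟩ := h1.split hu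
      exact ⟨S2, h3, fun h => h2 (h4 h)⟩
    · exact ⟨_, cons h h1 hu, by simp [h2, hz.1]⟩

lemma ofConn {z : V} (hz : (G.induce ({z}ᶜ : Set V)).Connected) (u v : V) (hu : u ≠ z)
    (hv : v ≠ z) : ∃ Q, PathOn G u v Q ∧ z ∉ Q := by
  have hu' : u ∈ ({z}ᶜ : Set V) := by simpa using hu
  have hv' : v ∈ ({z}ᶜ : Set V) := by simpa using hv
  obtain ⟨w⟩ := hz.preconnected ⟨u, hu'⟩ ⟨v, hv'⟩
  have h := ofWalk (z := z) (w.map (SimpleGraph.Embedding.induce _).toHom) (by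
    rw [SimpleGraph.Walk.support_map]
    simp)
  exact h

lemma between {z : V} (hz : (G.induce ({z}ᶜ : Set V)).Connected) (S T : Set V)
    (hS : ∃ u ∈ S, u ≠ z) (hT : ∃ u ∈ T, u ≠ z) :
    ∃ u ∈ S, ∃ v ∈ T, ∃ Q, PathOn G u v Q ∧ z ∉ Q ∧ (∀ x ∈ Q, x ∈ S → x = u) ∧
      (∀ x ∈ Q, x ∈ T → x = v) := by
  have hex : ∃ n, ∃ u ∈ S, ∃ v ∈ T, ∃ Q, PathOn G u v Q ∧ z ∉ Q ∧ Q.card = n := by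
    obtain ⟨u, hu, huz⟩ := hS
    obtain ⟨v, hv, hvz⟩ := hT
    obtain ⟨Q, h1, h2⟩ := ofConn hz u v huz hvz
    exact ⟨_, u, hu, v, hv, Q, h1, h2, rfl⟩
  classical
  obtain ⟨u, hu, v, hv, Q, h1, h2, h3⟩ := Nat.find_spec hex
  refine ⟨u, hu, v, hv, Q, h1, h2, ?_, ?_⟩
  · intro x hx hxS
    by_contra hne
    obtain ⟨S1, S2, g1, g2, g3, g4, g5⟩ := h1.split hx
    have : S2.card < Q.card := Finset.card_lt_card ⟨g4, fun h =>
      hne (g5 u g1.left_mem (h h1.left_mem)).symm⟩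
    exact Nat.find_min hex (h3 ▸ this) ⟨x, hxS, v, hv, S2, g2, fun h => h2 (g4 h), rfl⟩
  · intro x hx hxS
    by_contra hne
    obtain ⟨S1, S2, g1, g2, g3, g4, g5⟩ := h1.split hx
    have : S1.card < Q.card := Finset.card_lt_card ⟨g3, fun h =>
      hne (g5 v (h h1.right_mem) g2.right_mem).symm⟩
    exact Nat.find_min hex (h3 ▸ this) ⟨u, hu, x, hxS, S1, g1, fun h => h2 (g3 h), rfl⟩

lemma clique (n : ℕ) : ∀ (K : Finset V), K.card = n → (∀ x ∈ K, ∀ y ∈ K, x ≠ y → G.Adj x y) →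
    ∀ u ∈ K, ∀ v ∈ K, u ≠ v → PathOn G u v K := by
  induction n with
  | zero => intro K hK; simp at hK; simp [hK]
  | succ n ih =>
    intro K hK hc u hu v hv huv
    rw [← Finset.insert_erase hu]
    by_cases h : ∃ x ∈ K, x ≠ u ∧ x ≠ v
    · obtain ⟨x, hx, hxu, hxv⟩ := h
      exact cons (hc u hu x hx hxu.symm) (ih (K.erase u) (by rw [Finset.card_erase_of_mem hu]; omega)
        (by grind) x (by grind) v (by grind) hxv) (by simp)
    · push Not at h
      have : K.erase u = {v} := by
        ext z; simp only [Finset.mem_erase, Finset.mem_singleton]; grind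
      rw [this]
      exact cons (hc u hu v hv huv) (single v) (by simpa using huv)

lemma addEdge {G' : SimpleGraph V} {x y : V} (hG : ∀ a b, G'.Adj a b → G.Adj a b ∨
      (a = x ∧ b = y) ∨ (a = y ∧ b = x)) {u v : V} {S : Finset V} (h : PathOn G' u v S) :
    PathOn G u v S ∨ ∃ S1 S2, Disjoint S1 S2 ∧ S1 ∪ S2 = S ∧
      ((PathOn G u x S1 ∧ PathOn G y v S2) ∨ (PathOn G u y S1 ∧ PathOn G x v S2)) := by
  induction h with
  | single u => exact .inl (single u)
  | @cons u v w S h hp hu ih =>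
    rcases ih with ih | ⟨S1, S2, hd, hun, ih⟩
    · rcases hG _ _ h with h | ⟨rfl, rfl⟩ | ⟨rfl, rfl⟩
      · exact .inl (cons h ih hu)
      · exact .inr ⟨{u}, S, by simpa using hu, by simp, .inl ⟨single _, ih⟩⟩
      · exact .inr ⟨{u}, S, by simpa using hu, by simp, .inr ⟨single _, ih⟩⟩
    · have hu1 : u ∉ S1 := by grind
      have hu2 : u ∉ S2 := by grind
      have hd' : Disjoint (insert u S1) S2 := by simp [hu2, hd]
      have hun' : insert u S1 ∪ S2 = insert u S := by rw [Finset.insert_union, hun]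
      have hx : G.Adj u v := by
        rcases hG _ _ h with h | ⟨rfl, rfl⟩ | ⟨rfl, rfl⟩
        · exact h
        · exfalso
          rcases ih with ⟨i1, i2⟩ | ⟨i1, i2⟩
          · exact hu1 i1.right_mem
          · exact hu2 i2.left_mem
        · exfalso
          rcases ih with ⟨i1, i2⟩ | ⟨i1, i2⟩
          · exact hu2 i2.left_mem
          · exact hu1 i1.right_mem
      exact .inr ⟨_, S2, hd', hun', ih.imp (fun i => ⟨cons hx i.1 hu1, i.2⟩)
        (fun i => ⟨cons hx i.1 hu1, i.2⟩)⟩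

end PathOn

section posa
variable {V : Type*} [DecidableEq V] {G : SimpleGraph V}

/-- Two disjoint paths from the initial segment `p 0..p a` to the final segment `p j..p m`. -/
def TwoPaths (G : SimpleGraph V) (p : ℕ → V) (m a j : ℕ) : Prop :=
  ∃ (s t α β : ℕ) (RA RB : Finset V), s < a ∧ j < t ∧ t ≤ m ∧
    ((α = a ∧ β = s) ∨ (α = s ∧ β = a)) ∧ PathOn G (p α) (p j) RA ∧ PathOn G (p β) (p t) RB ∧
    Disjoint RA RB ∧
    ∀ i, i ≤ m → (p i ∈ RA ∨ p i ∈ RB) → (i = s ∨ i = a ∨ i = j ∨ i = t ∨ (a < i ∧ i < j))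

lemma twoPaths_base {m : ℕ} {p : ℕ → V} (hi : ∀ i j, i ≤ m → j ≤ m → p i = p j → i = j)
    (h2 : ∀ z : V, (G.induce ({z}ᶜ : Set V)).Connected) (a : ℕ) (ha0 : 0 < a) (ham : a < m) :
    TwoPaths G p m a a := by
  obtain ⟨u, ⟨s, hs, rfl⟩, v, ⟨t, ⟨ht, htm⟩, rfl⟩, Q, hQ, hz, hQS, hQT⟩ :=
    PathOn.between (h2 (p a)) (p '' {i | i < a}) (p '' {i | a < i ∧ i ≤ m})
    ⟨p 0, ⟨0, ha0, rfl⟩, fun h => by have := hi _ _ (by omega) (by omega) h; omega⟩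
    ⟨p m, ⟨m, ⟨ham, le_rfl⟩, rfl⟩, fun h => by have := hi _ _ (by omega) (by omega) h; omega⟩
  simp only [Set.mem_ofPred_eq] at hs
  refine ⟨s, t, a, s, {p a}, Q, hs, ht, htm, .inl ⟨rfl, rfl⟩, .single _, hQ, by simpa using hz, ?_⟩
  rintro i him (h | h)
  · have := hi _ _ (by omega) (by omega) (Finset.mem_singleton.1 h); omega
  · rcases lt_trichotomy i a with hia | rfl | hia
    · have := hi _ _ (by omega) (by omega) (hQS _ h ⟨i, hia, rfl⟩); omega
    · exact absurd h hz
    · have := hi _ _ (by omega) (by omega) (hQT _ h ⟨i, ⟨hia, him⟩, rfl⟩); omega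

lemma twoPaths_step {m : ℕ} {p : ℕ → V} (hi : ∀ i j, i ≤ m → j ≤ m → p i = p j → i = j)
    (hadj : ∀ i, i < m → G.Adj (p i) (p (i+1)))
    (h2 : ∀ z : V, (G.induce ({z}ᶜ : Set V)).Connected) (a j : ℕ) (haj : a ≤ j)
    (hjm : j + 1 < m) (h : TwoPaths G p m a j) : TwoPaths G p m a (j + 1) := by
  obtain ⟨s, t, α, β, RA, RB, hs, ht, htm, hαβ, hA, hB, hd, hR⟩ := h
  have hdis : ∀ z, z ∈ RA → z ∈ RB → False := fun z h h' => Finset.disjoint_left.1 hd h h'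
  by_cases htj : t = j + 1
  swap
  · have hA' : p (j+1) ∉ RA := fun h => by have := hR _ (by omega) (.inl h); omega
    have hB' : p (j+1) ∉ RB := fun h => by have := hR _ (by omega) (.inr h); omega
    refine ⟨s, t, α, β, _, RB, hs, by omega, htm, hαβ, hA.snoc (hadj j (by omega)) hA', hB,
      by simp [hB', hd], ?_⟩
    rintro i him (h | h)
    · rcases Finset.mem_insert.1 h with h | h
      · have := hi _ _ (by omega) (by omega) h; omega
      · have := hR i him (.inl h); omega
    · have := hR i him (.inr h); omega
  subst htj
  have hA' : p (j+1) ∉ RA := fun h => hdis _ h hB.right_mem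
  have hsa : p s ∈ RA ∨ p s ∈ RB := by
    rcases hαβ with ⟨rfl, rfl⟩ | ⟨rfl, rfl⟩
    · exact .inr hB.left_mem
    · exact .inl hA.left_mem
  obtain ⟨w, hw, v, ⟨t, ⟨ht', htm'⟩, rfl⟩, Q, hQ, hz, hQS, hQT⟩ :=
    PathOn.between (h2 (p (j+1))) (p '' {i | i ≤ a} ∪ {z | z ∈ RA} ∪ {z | z ∈ RB})
      (p '' {i | j + 1 < i ∧ i ≤ m})
    ⟨p j, .inl (.inr hA.right_mem), fun h => by have := hi _ _ (by omega) (by omega) h; omega⟩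
    ⟨p m, ⟨m, ⟨hjm, le_rfl⟩, rfl⟩, fun h => by have := hi _ _ (by omega) (by omega) h; omega⟩
  have hwQ := hQ.left_mem
  have hwne : w ≠ p (j+1) := fun h => hz (h ▸ hwQ)
  have QA : ∀ x ∈ Q, x ∈ RA → x = w := fun x hx h => hQS x hx (.inl (.inr h))
  have QB : ∀ x ∈ Q, x ∈ RB → x = w := fun x hx h => hQS x hx (.inr h)
  have QP : ∀ i ≤ m, p i ∈ Q → p i = w ∨ i = t ∨ (a < i ∧ i < j + 1) := by
    intro i him hQi
    by_cases h1 : i ≤ a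
    · exact .inl (hQS _ hQi (.inl (.inl ⟨i, h1, rfl⟩)))
    by_cases h2 : i < j + 1
    · exact .inr (.inr (by omega))
    by_cases h3 : i = j + 1
    · subst h3; exact absurd hQi hz
    · exact .inr (.inl (hi _ _ him htm' (hQT _ hQi ⟨i, ⟨by omega, him⟩, rfl⟩)))
  by_cases hwA : w ∈ RA
  · obtain ⟨S1, S2, g1, g2, g3, g4, g5⟩ := hA.split hwA
    refine ⟨s, t, β, α, RB, S1 ∪ Q, hs, ht', htm', by omega, hB,
      g1.join hQ (fun z h1 h2 => QA z h2 (g3 h1)), ?_, ?_⟩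
    · rw [Finset.disjoint_left]
      intro z hzB hz1
      rcases Finset.mem_union.1 hz1 with hz1 | hz1
      · exact hdis z (g3 hz1) hzB
      · have := QB z hz1 hzB; subst this; exact hdis _ hwA hzB
    · intro i him h
      have key : p i ∈ RA ∨ p i ∈ RB → i = s ∨ i = a ∨ i = j + 1 ∨ i = t ∨ (a < i ∧ i < j + 1) := by
        intro h; have := hR i him h; omega
      rcases h with h | h
      · exact key (.inr h)
      · rcases Finset.mem_union.1 h with h | h
        · exact key (.inl (g3 h))
        · rcases QP i him h with h | h | h
          · exact key (.inl (h ▸ hwA))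
          · omega
          · omega
  by_cases hwB : w ∈ RB
  · obtain ⟨S1, S2, g1, g2, g3, g4, g5⟩ := hB.split hwB
    have hn1 : p (j+1) ∉ S1 := fun h => hwne (g5 _ h g2.right_mem).symm
    refine ⟨s, t, α, β, insert (p (j+1)) RA, S1 ∪ Q, hs, ht', htm', hαβ,
      hA.snoc (hadj j (by omega)) hA', 
      g1.join hQ (fun z h1 h2 => QB z h2 (g3 h1)), ?_, ?_⟩
    · rw [Finset.disjoint_insert_left, Finset.mem_union, not_or]
      refine ⟨⟨hn1, hz⟩, ?_⟩
      rw [Finset.disjoint_left]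
      intro z hzB hz1
      rcases Finset.mem_union.1 hz1 with hz1 | hz1
      · exact hdis z hzB (g3 hz1)
      · have := QA z hz1 hzB; subst this; exact hwA hzB
    · intro i him h
      have key : p i ∈ RA ∨ p i ∈ RB → i = s ∨ i = a ∨ i = j + 1 ∨ i = t ∨ (a < i ∧ i < j + 1) := by
        intro h; have := hR i him h; omega
      rcases h with h | h
      · rcases Finset.mem_insert.1 h with h | h
        · have := hi _ _ him (by omega) h; omega
        · exact key (.inl h)
      · rcases Finset.mem_union.1 h with h | h
        · exact key (.inr (g3 h))
        · rcases QP i him h with h | h | h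
          · exact key (.inr (h ▸ hwB))
          · omega
          · omega
  -- new start in the initial segment
  rcases hw with (⟨s', hs', rfl⟩ | hw) | hw
  rotate_left
  · exact absurd hw hwA
  · exact absurd hw hwB
  simp only [Set.mem_ofPred_eq] at hs'
  have hpa : p a ∈ RA ∨ p a ∈ RB := by
    rcases hαβ with ⟨rfl, rfl⟩ | ⟨rfl, rfl⟩
    · exact .inl hA.left_mem
    · exact .inr hB.left_mem
  have hs'a : s' < a := by
    rcases hs'.lt_or_eq with h | h
    · exact h
    · subst h; tauto
  have QP' : ∀ i ≤ m, p i ∈ Q → i = s' ∨ i = t ∨ (a < i ∧ i < j + 1) := by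
    intro i him h
    rcases QP i him h with h | h
    · exact .inl (hi _ _ him (by omega) h)
    · exact .inr h
  rcases hαβ with ⟨rfl, rfl⟩ | ⟨rfl, rfl⟩
  · refine ⟨s', t, α, s', insert (p (j+1)) RA, Q, hs'a, ht', htm', .inl ⟨rfl, rfl⟩,
      hA.snoc (hadj j (by omega)) hA', hQ, ?_, ?_⟩
    · rw [Finset.disjoint_insert_left]
      refine ⟨hz, Finset.disjoint_left.2 fun x h1 h2 => hwA (QA x h2 h1 ▸ h1)⟩
    · rintro i him (h | h)
      · rcases Finset.mem_insert.1 h with h | h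
        · have := hi _ _ him (by omega) h; omega
        · have := hR i him (.inl h)
          have : i ≠ β := by rintro rfl; exact hdis _ h hB.left_mem
          omega
      · have := QP' i him h; omega
  · refine ⟨s', t, β, s', RB, Q, hs'a, ht', htm', .inl ⟨rfl, rfl⟩,
      hB, hQ, ?_, ?_⟩
    · refine Finset.disjoint_left.2 fun x h1 h2 => hwB (QB x h2 h1 ▸ h1)
    · rintro i him (h | h)
      · have := hR i him (.inr h)
        have : i ≠ α := by rintro rfl; exact hdis _ hA.left_mem h
        omega
      · have := QP' i him h; omega

lemma twoPaths {m : ℕ} {p : ℕ → V} (hi : ∀ i j, i ≤ m → j ≤ m → p i = p j → i = j)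
    (hadj : ∀ i, i < m → G.Adj (p i) (p (i+1)))
    (h2 : ∀ z : V, (G.induce ({z}ᶜ : Set V)).Connected) (a b : ℕ) (ha0 : 0 < a) (hab : a ≤ b)
    (hbm : b < m) : TwoPaths G p m a b := by
  induction b, hab using Nat.le_induction with
  | base => exact twoPaths_base hi h2 a ha0 hbm
  | succ j hj ih => exact twoPaths_step hi hadj h2 a j hj hbm (ih (by omega))

lemma posa_cross {m : ℕ} {p : ℕ → V} (hi : ∀ i j, i ≤ m → j ≤ m → p i = p j → i = j)
    (hadj : ∀ i, i < m → G.Adj (p i) (p (i+1))) (c : ℕ) (hc : c ≤ m + 1)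
    (NX NY : Finset ℕ) (hNX : ∀ i, i ∈ NX ↔ i ≤ m ∧ G.Adj (p 0) (p i))
    (hNY : ∀ i, i ∈ NY ↔ i ≤ m ∧ G.Adj (p m) (p i)) (hcard : c ≤ NX.card + NY.card)
    (hcr : ∃ d i j, i ∈ NY ∧ j ∈ NX ∧ i < j ∧ j = i + d) :
    ∃ u v T, PathOn G u v T ∧ G.Adj u v ∧ c ≤ T.card := by
  classical
  obtain ⟨i, j, hiY, hjX, hij, hd⟩ := Nat.find_spec hcr
  have hmin : ∀ i' j', i' ∈ NY → j' ∈ NX → i' < j' → j - i ≤ j' - i' := by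
    intro i' j' h1 h2 h3
    by_contra hlt
    exact Nat.find_min hcr (m := j' - i') (by omega) ⟨i', j', h1, h2, h3, by omega⟩
  have hjm := ((hNX j).1 hjX).1
  have hi1 : PathOn G (p 0) (p i) _ := PathOn.seg hi hadj 0 i (by omega) (by omega)
  have hj1 : PathOn G (p j) (p m) _ := PathOn.seg hi hadj j m (by omega) (by omega)
  have inj : Set.InjOn p (Set.Iic m) := fun x hx y hy h => hi x y hx hy h
  have hT := hi1.append hj1.symm ((hNY i).1 hiY).2.symm (by
    rw [Finset.disjoint_left]
    simp only [Finset.mem_image, Finset.mem_Icc]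
    rintro z ⟨x, hx, rfl⟩ ⟨y, hy, he⟩
    have := hi _ _ (by omega) (by omega) he
    omega)
  refine ⟨_, _, _, hT, ((hNX j).1 hjX).2, ?_⟩
  rw [← Finset.image_union, Finset.card_image_of_injOn (inj.mono (by
    intro x; simp; omega))]
  rw [Finset.card_union_of_disjoint (by rw [Finset.disjoint_left]; simp; omega)]
  simp only [Nat.card_Icc]
  by_cases hj' : j = i + 1
  · omega
  -- counting
  have h0 : ∀ x ∈ NX, 1 ≤ x := by
    intro x hx
    rcases Nat.eq_zero_or_pos x with rfl | h
    · exact absurd ((hNX 0).1 hx).2 (G.loopless.irrefl _)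
    · exact h
  have hm' : m ∉ NY := fun h => G.loopless.irrefl _ ((hNY m).1 h).2
  have hYle : ∀ x ∈ NY, x ≤ m := fun x hx => ((hNY x).1 hx).1
  have hXle : ∀ x ∈ NX, x ≤ m := fun x hx => ((hNX x).1 hx).1
  have hsub : (NX.image (· - 1)) ∪ NY ⊆ insert (j-1) (Finset.Icc 0 i ∪ Finset.Ico j m) := by
    intro z hz
    simp only [Finset.mem_union, Finset.mem_image, Finset.mem_insert, Finset.mem_Icc,
      Finset.mem_Ico] at hz ⊢
    rcases hz with ⟨x, hx, rfl⟩ | hz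
    · have := h0 x hx
      have := hXle x hx
      have : i < x → j ≤ x := fun h => by have := hmin i x hiY hx h; omega
      omega
    · have := hYle z hz
      have : z ≠ m := by rintro rfl; exact hm' hz
      have : z < j → z ≤ i := fun h => by have := hmin z j hz hjX h; omega
      omega
  have h1 := Finset.card_le_card hsub
  have h3 := Finset.card_insert_le (j-1) (Finset.Icc 0 i ∪ Finset.Ico j m)
  have h4 := Finset.card_union_le (Finset.Icc 0 i) (Finset.Ico j m)
  rw [Finset.card_union_of_disjoint, Finset.card_image_of_injOn] at h1
  · simp only [Nat.card_Icc, Nat.card_Ico] at h4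
    omega
  · intro x hx y hy h
    have := h0 x hx
    have := h0 y hy
    simp at h; omega
  · rw [Finset.disjoint_left]
    simp only [Finset.mem_image]
    rintro z ⟨x, hx, rfl⟩ hz
    have := h0 x hx
    have := hmin _ x hz hx (by omega)
    omega

lemma posa_nocross {m : ℕ} {p : ℕ → V} (hi : ∀ i j, i ≤ m → j ≤ m → p i = p j → i = j)
    (hadj : ∀ i, i < m → G.Adj (p i) (p (i+1))) (c : ℕ) 
    (h2 : ∀ z : V, (G.induce ({z}ᶜ : Set V)).Connected) (hm : 0 < m)
    (NX NY : Finset ℕ) (hNX : ∀ i, i ∈ NX ↔ i ≤ m ∧ G.Adj (p 0) (p i))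
    (hNY : ∀ i, i ∈ NY ↔ i ≤ m ∧ G.Adj (p m) (p i)) (hcard : c ≤ NX.card + NY.card)
    (hcr : ∀ i j, i ∈ NY → j ∈ NX → j ≤ i) :
    ∃ u v T, PathOn G u v T ∧ G.Adj u v ∧ c ≤ T.card := by
  have inj : Set.InjOn p (Set.Iic m) := fun x hx y hy h => hi x y hx hy h
  have h1X : 1 ∈ NX := (hNX 1).2 ⟨hm, hadj 0 hm⟩
  have h1Y : m - 1 ∈ NY := (hNY _).2 ⟨by omega, by
    have := (hadj (m-1) (by omega)).symm
    rwa [show m - 1 + 1 = m by omega] at this⟩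
  obtain ⟨a, haX, hamax⟩ := NX.exists_max_image id ⟨1, h1X⟩
  obtain ⟨b, hbY, hbmin⟩ := NY.exists_min_image id ⟨_, h1Y⟩
  simp only [id] at hamax hbmin
  have ha1 := hamax _ h1X
  have hb1 := hbmin _ h1Y
  have hab := hcr _ _ hbY haX
  obtain ⟨s, t, α, β, RA, RB, hs, ht, htm, hαβ, hA, hB, hd, hR⟩ :=
    twoPaths hi hadj h2 a b (by omega) hab (by omega)
  have hdis : ∀ z, z ∈ RA → z ∈ RB → False := fun z h h' => Finset.disjoint_left.1 hd h h'
  obtain ⟨s', hs'X, hs'min⟩ := (NX.filter (s < ·)).exists_min_image id ⟨a, by simp [haX, hs]⟩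
  obtain ⟨t', ht'Y, ht'max⟩ := (NY.filter (· < t)).exists_max_image id ⟨b, by simp [hbY, ht]⟩
  simp only [id, Finset.mem_filter] at hs'X hs'min ht'Y ht'max
  have hs'a := hamax _ hs'X.1
  have hbt' := hbmin _ ht'Y.1
  -- the path on the y side
  have hY1 : PathOn G (p t) (p m) _ := PathOn.seg hi hadj t m (by omega) (by omega)
  have hY2 : PathOn G (p b) (p t') _ := PathOn.seg hi hadj b t' (by omega) (by omega)
  have hY := hY1.append hY2.symm ((hNY t').1 ht'Y.1).2 (by
    rw [Finset.disjoint_left]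
    simp only [Finset.mem_image, Finset.mem_Icc]
    rintro z ⟨x, hx, rfl⟩ ⟨y, hy, he⟩
    have := hi _ _ (by omega) (by omega) he
    omega)
  rw [← Finset.image_union] at hY
  set IY := Finset.Icc t m ∪ Finset.Icc b t' with hIY
  have mIY : ∀ i, i ∈ IY ↔ (t ≤ i ∧ i ≤ m) ∨ (b ≤ i ∧ i ≤ t') := by simp [IY]
  have hU1 := hB.join hY (by
    intro z hz hzI
    obtain ⟨i, hiI, rfl⟩ := Finset.mem_image.1 hzI
    rw [mIY] at hiI
    have h3 := hR i (by omega) (.inr hz)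
    have h4 : i ≠ b := by rintro rfl; exact hdis _ hA.right_mem hz
    have : i = t := by omega
    rw [this])
  have hU2 := hU1.join hA.symm (by
    intro z hz hzA
    rcases Finset.mem_union.1 hz with hz | hz
    · exact (hdis z hzA hz).elim
    · obtain ⟨i, hiI, rfl⟩ := Finset.mem_image.1 hz
      rw [mIY] at hiI
      have h3 := hR i (by omega) (.inl hzA)
      have h4 : i ≠ t := by rintro rfl; exact hdis _ hzA hB.right_mem
      have : i = b := by omega
      rw [this])
  set U := RB ∪ Finset.image p IY ∪ RA with hUdef
  have hU : PathOn G (p s) (p a) U := by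
    rcases hαβ with ⟨rfl, rfl⟩ | ⟨rfl, rfl⟩
    · exact hU2
    · exact hU2.symm
  have hUi : ∀ i ≤ a, p i ∈ U → i = s ∨ i = a := by
    intro i hia h
    rw [hUdef, Finset.mem_union, Finset.mem_union] at h
    rcases h with (h | h) | h
    · have := hR i (by omega) (.inr h); omega
    · obtain ⟨l, hl, he⟩ := Finset.mem_image.1 h
      rw [mIY] at hl
      have := hi _ _ (by omega) (by omega) he
      omega
    · have := hR i (by omega) (.inl h); omega
  have hX1 : PathOn G (p 0) (p s) _ := PathOn.seg hi hadj 0 s (by omega) (by omega)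
  have hX2 : PathOn G (p s') (p a) _ := PathOn.seg hi hadj s' a (by omega) (by omega)
  have hW := hX1.join hU (by
    intro z hz hzU
    obtain ⟨i, hiI, rfl⟩ := Finset.mem_image.1 hz
    rw [Finset.mem_Icc] at hiI
    have := hUi i (by omega) hzU
    rw [show i = s by omega])
  have hT := hW.join hX2.symm (by
    intro z hz hzI
    obtain ⟨i, hiI, rfl⟩ := Finset.mem_image.1 hzI
    rw [Finset.mem_Icc] at hiI
    rcases Finset.mem_union.1 hz with hz | hz
    · obtain ⟨l, hl, he⟩ := Finset.mem_image.1 hz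
      rw [Finset.mem_Icc] at hl
      have := hi _ _ (by omega) (by omega) he
      omega
    · have := hUi i (by omega) hz
      rw [show i = a by omega])
  refine ⟨_, _, _, hT, ((hNX s').1 hs'X.1).2, ?_⟩
  have h0X : 0 ∉ NX := fun h => G.loopless.irrefl _ ((hNX 0).1 h).2
  have hYle : ∀ x ∈ NY, x ≤ m := fun x hx => ((hNY x).1 hx).1
  have hXle : ∀ x ∈ NX, x ≤ m := fun x hx => ((hNX x).1 hx).1
  have hcardI : (insert 0 NX ∪ NY.erase b).card = NX.card + 1 + (NY.card - 1) := by
    rw [Finset.card_union_of_disjoint, Finset.card_insert_of_notMem h0X,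
      Finset.card_erase_of_mem hbY]
    rw [Finset.disjoint_left]
    intro x hx hx'
    rw [Finset.mem_erase] at hx'
    have := hbmin x hx'.2
    rcases Finset.mem_insert.1 hx with rfl | hx
    · omega
    · have := hamax x hx; omega
  have hYpos : 0 < NY.card := Finset.card_pos.2 ⟨b, hbY⟩
  calc c ≤ (insert 0 NX ∪ NY.erase b).card := by omega
    _ = ((insert 0 NX ∪ NY.erase b).image p).card := by
      rw [Finset.card_image_of_injOn (inj.mono _)]
      intro x hx
      simp at hx ⊢
      rcases hx with rfl | hx | hx
      · omega
      · exact hXle _ hx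
      · exact hYle _ hx.1
    _ ≤ _ := by
      apply Finset.card_le_card
      intro z hz
      obtain ⟨x, hx, rfl⟩ := Finset.mem_image.1 hz
      simp only [Finset.mem_union, Finset.mem_insert, Finset.mem_erase] at hx
      have m1 : ∀ x, x ≤ s → p x ∈ (Finset.Icc 0 s).image p := fun x hx =>
        Finset.mem_image.2 ⟨x, by simp [hx], rfl⟩
      have m2 : ∀ x, s' ≤ x → x ≤ a → p x ∈ (Finset.Icc s' a).image p := fun x hx hx' =>
        Finset.mem_image.2 ⟨x, by simp [hx, hx'], rfl⟩
      rcases hx with (rfl | hx) | hx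
      · exact Finset.mem_union_left _ (Finset.mem_union_left _ (m1 0 (by omega)))
      · by_cases hxs : x ≤ s
        · exact Finset.mem_union_left _ (Finset.mem_union_left _ (m1 x hxs))
        · exact Finset.mem_union_right _ (m2 x (hs'min x ⟨hx, by omega⟩) (hamax x hx))
      · refine Finset.mem_union_left _ (Finset.mem_union_right _ ?_)
        refine Finset.mem_union_left _ (Finset.mem_union_right _ ?_)
        refine Finset.mem_image.2 ⟨x, ?_, rfl⟩
        rw [mIY]
        by_cases hxt : x < t
        · exact .inr ⟨hbmin _ hx.2, ht'max x ⟨hx.2, hxt⟩⟩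
        · exact .inl ⟨by omega, hYle _ hx.2⟩

lemma posa (h2 : ∀ z : V, (G.induce ({z}ᶜ : Set V)).Connected) (c : ℕ) {x y : V} {S : Finset V}
    (hxy : x ≠ y) (hP : PathOn G x y S) (hS : c ≤ S.card) (NX NY : Finset V)
    (hNX : ∀ z ∈ NX, z ∈ S ∧ G.Adj x z) (hNY : ∀ z ∈ NY, z ∈ S ∧ G.Adj y z)
    (hcard : c ≤ NX.card + NY.card) :
    ∃ u v T, PathOn G u v T ∧ G.Adj u v ∧ c ≤ T.card := by
  classical
  obtain ⟨m, p, rfl, rfl, hSp, hi, hadj⟩ := hP.toFun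
  have hm : 0 < m := by
    rcases Nat.eq_zero_or_pos m with rfl | h
    · exact absurd rfl hxy
    · exact h
  have hSc : S.card ≤ m + 1 := by
    rw [hSp]; exact Finset.card_image_le.trans (by simp)
  let IX := (Finset.range (m+1)).filter fun i => G.Adj (p 0) (p i)
  let IY := (Finset.range (m+1)).filter fun i => G.Adj (p m) (p i)
  have hIX : ∀ i, i ∈ IX ↔ i ≤ m ∧ G.Adj (p 0) (p i) := by intro i; simp [IX]
  have hIY : ∀ i, i ∈ IY ↔ i ≤ m ∧ G.Adj (p m) (p i) := by intro i; simp [IY]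
  have cX : NX.card ≤ IX.card := by
    refine (Finset.card_le_card (t := IX.image p) ?_).trans Finset.card_image_le
    intro z hz
    obtain ⟨h1, h2⟩ := hNX z hz
    rw [hSp] at h1
    obtain ⟨i, h3, rfl⟩ := Finset.mem_image.1 h1
    exact Finset.mem_image.2 ⟨i, (hIX i).2 ⟨by simp at h3; omega, h2⟩, rfl⟩
  have cY : NY.card ≤ IY.card := by
    refine (Finset.card_le_card (t := IY.image p) ?_).trans Finset.card_image_le
    intro z hz
    obtain ⟨h1, h2⟩ := hNY z hz
    rw [hSp] at h1
    obtain ⟨i, h3, rfl⟩ := Finset.mem_image.1 h1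
    exact Finset.mem_image.2 ⟨i, (hIY i).2 ⟨by simp at h3; omega, h2⟩, rfl⟩
  by_cases hcr : ∀ i j, i ∈ IY → j ∈ IX → j ≤ i
  · exact posa_nocross hi hadj c h2 hm IX IY hIX hIY (by omega) hcr
  · push Not at hcr
    obtain ⟨i, j, h3, h4, h5⟩ := hcr
    exact posa_cross hi hadj c (by omega) IX IY hIX hIY (by omega)
      ⟨j - i, i, j, h3, h4, h5, by omega⟩

end posa

section main
variable {V : Type*} [DecidableEq V] {G : SimpleGraph V}

/-- no cycle of length at least `c`, in terms of `PathOn` -/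
def NoLong (G : SimpleGraph V) (c : ℕ) : Prop :=
  ∀ u v S, PathOn G u v S → G.Adj u v → S.card < c

lemma long_path_of_maximal {c : ℕ} (hc : 3 ≤ c) (hno : NoLong G c)
    (hmax : ∀ G' : SimpleGraph V, G ≤ G' → NoLong G' c → G' ≤ G) {x y : V} (hxy : x ≠ y)
    (hn : ¬ G.Adj x y) : ∃ S, PathOn G x y S ∧ c ≤ S.card := by
  let G' := G ⊔ SimpleGraph.edge x y
  have hG : ∀ a b, G'.Adj a b → G.Adj a b ∨ (a = x ∧ b = y) ∨ (a = y ∧ b = x) := by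
    intro a b h
    simp only [G', SimpleGraph.sup_adj, SimpleGraph.edge_adj] at h
    tauto
  have hx' : G'.Adj x y := by
    simp [G', SimpleGraph.sup_adj, SimpleGraph.edge_adj, hxy]
  have h1 : ¬ NoLong G' c := fun h => hn (hmax G' le_sup_left h hx')
  simp only [NoLong] at h1
  push Not at h1
  obtain ⟨u, v, S, hP, huv, hS⟩ := h1
  rcases PathOn.addEdge hG hP with hP1 | ⟨S1, S2, hd, hun, hP⟩
  · rcases hG _ _ huv with h | ⟨rfl, rfl⟩ | ⟨rfl, rfl⟩
    · exact absurd (hno _ _ _ hP1 h) (by omega)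
    · exact ⟨S, hP1, hS⟩
    · exact ⟨S, hP1.symm, hS⟩
  · have hdis : ∀ z, z ∈ S1 → z ∈ S2 → False := fun z h h' => Finset.disjoint_left.1 hd h h'
    have hcu := Finset.card_union_le S1 S2
    rw [hun] at hcu
    have huv' : G.Adj u v := by
      rcases hG _ _ huv with h | ⟨rfl, rfl⟩ | ⟨rfl, rfl⟩
      · exact h
      · exfalso
        rcases hP with ⟨i1, i2⟩ | ⟨i1, i2⟩
        · rw [i1.self_eq rfl, i2.self_eq rfl] at hcu; simp at hcu; omega
        · exact hdis _ i1.right_mem i2.right_mem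
      · exfalso
        rcases hP with ⟨i1, i2⟩ | ⟨i1, i2⟩
        · exact hdis _ i1.right_mem i2.right_mem
        · rw [i1.self_eq rfl, i2.self_eq rfl] at hcu; simp at hcu; omega
    rcases hP with ⟨i1, i2⟩ | ⟨i1, i2⟩
    · exact ⟨S, hun ▸ i1.symm.append i2.symm huv' hd, hS⟩
    · exact ⟨S, (hun ▸ i1.symm.append i2.symm huv' hd : PathOn G y x S).symm, hS⟩

lemma all_adj [Fintype V] [DecidableRel G.Adj] {c : ℕ} (hc : 3 ≤ c) (hno : NoLong G c)
    (h2 : ∀ z : V, (G.induce ({z}ᶜ : Set V)).Connected)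
    (hmax : ∀ G' : SimpleGraph V, G ≤ G' → NoLong G' c → G' ≤ G)
    (X Y : Finset V) (d1 d2 : ℕ) (hX : ∀ x ∈ X, d1 ≤ (X.filter (G.Adj x)).card)
    (hY : ∀ x ∈ Y, d2 ≤ (Y.filter (G.Adj x)).card) (hd : c ≤ d1 + d2) :
    ∀ x ∈ X, ∀ y ∈ Y, x ≠ y → G.Adj x y := by
  intro x0 hx0 y0 hy0 hne0
  by_contra hna0
  obtain ⟨S0, hP0, hS0⟩ := long_path_of_maximal hc hno hmax hne0 hna0
  let P : ℕ → Prop := fun n => ∃ x ∈ X, ∃ y ∈ Y, x ≠ y ∧ ¬ G.Adj x y ∧ ∃ S, PathOn G x y S ∧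
    S.card = n
  have hbd : ∀ n, P n → n ≤ Fintype.card V := by
    rintro n ⟨_, _, _, _, _, _, S, _, rfl⟩
    exact Finset.card_le_univ S
  classical
  have hp0 : P S0.card := ⟨x0, hx0, y0, hy0, hne0, hna0, S0, hP0, rfl⟩
  have hspec := Nat.findGreatest_spec (hbd _ hp0) hp0
  have hgr : ∀ n, P n → n ≤ Nat.findGreatest P (Fintype.card V) := fun n hn =>
    Nat.le_findGreatest (hbd n hn) hn
  have hge := hgr _ hp0
  obtain ⟨x, hx, y, hy, hne, hna, S, hP, hS⟩ := hspec
  rw [← hS] at hgr hge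
  obtain ⟨u, v, T, hT, huv, hcT⟩ := posa h2 c hne hP (hS0.trans hge) (X.filter (G.Adj x))
    (Y.filter (G.Adj y)) (by
      intro z hz
      rw [Finset.mem_filter] at hz
      refine ⟨?_, hz.2⟩
      by_contra hzS
      have hP' := PathOn.cons hz.2.symm hP hzS
      have hcc := Finset.card_insert_of_notMem hzS
      by_cases hzy : G.Adj z y
      · have := hno _ _ _ hP' hzy; omega
      · have := hgr _ ⟨z, hz.1, y, hy, by rintro rfl; exact hzS hP.right_mem, hzy, _, hP', rfl⟩
        omega) (by
      intro z hz
      rw [Finset.mem_filter] at hz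
      refine ⟨?_, hz.2⟩
      by_contra hzS
      have hP' := PathOn.snoc hP hz.2 hzS
      have hcc := Finset.card_insert_of_notMem hzS
      by_cases hzy : G.Adj x z
      · have := hno _ _ _ hP' hzy; omega
      · have := hgr _ ⟨x, hx, z, hz.1, by rintro rfl; exact hzS hP.left_mem, hzy, _, hP', rfl⟩
        omega) (hd.trans (add_le_add (hX x hx) (hY y hy)))
  exact absurd (hno _ _ _ hT huv) (by omega)

/-- the `(k+1)`-core -/
def core_s9 [Fintype V] (G : SimpleGraph V) [DecidableRel G.Adj] (k : ℕ) : Finset V :=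
  Finset.univ.filter fun v => ∃ S : Finset V, v ∈ S ∧ ∀ u ∈ S, k + 1 ≤ (S.filter (G.Adj u)).card

lemma subset_core [Fintype V] [DecidableRel G.Adj] {k : ℕ} {S : Finset V}
    (hS : ∀ u ∈ S, k + 1 ≤ (S.filter (G.Adj u)).card) : S ⊆ core_s9 G k := by
  intro v hv
  simp only [core_s9, Finset.mem_filter, Finset.mem_univ, true_and]
  exact ⟨S, hv, hS⟩

lemma core_deg [Fintype V] [DecidableRel G.Adj] {k : ℕ} :
    ∀ u ∈ core_s9 G k, k + 1 ≤ ((core_s9 G k).filter (G.Adj u)).card := by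
  intro u hu
  have hu' := hu
  simp only [core_s9, Finset.mem_filter, Finset.mem_univ, true_and] at hu'
  obtain ⟨S, huS, hS⟩ := hu'
  exact (hS u huS).trans (Finset.card_le_card (Finset.filter_subset_filter _ (subset_core hS)))

open Classical in
lemma edges_bound [Fintype V] [DecidableRel G.Adj] (k b : ℕ) (hb : (core_s9 G k).card ≤ b) (n : ℕ) :
    ∀ T : Finset V, T.card = b + n → core_s9 G k ⊆ T →
    ((T.powersetCard 2).filter (fun s : Finset V => G.IsClique (s : Set V))).card ≤ b.choose 2 + n * k := by
  induction n with
  | zero =>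
    intro T hT _
    refine (Finset.card_filter_le _ _).trans ?_
    rw [Finset.card_powersetCard, hT]; simp
  | succ n ih =>
    intro T hT hco
    have : ∃ v ∈ T, (T.filter (G.Adj v)).card < k + 1 := by
      by_contra hcon
      push Not at hcon
      have := Finset.card_le_card (subset_core hcon)
      omega
    obtain ⟨v, hvT, hv⟩ := this
    have hvc : v ∉ core_s9 G k := fun h => by
      have h1 := core_deg v h
      have h2 := Finset.card_le_card (Finset.filter_subset_filter (G.Adj v) hco)
      omega
    have h1 := ih (T.erase v) (by rw [Finset.card_erase_of_mem hvT]; omega) (by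
      intro z hz
      exact Finset.mem_erase.2 ⟨by rintro rfl; exact hvc hz, hco hz⟩)
    have hsub : (T.powersetCard 2).filter (fun s : Finset V => G.IsClique (s : Set V)) ⊆
        ((T.erase v).powersetCard 2).filter (fun s : Finset V => G.IsClique (s : Set V)) ∪
        (T.filter (G.Adj v)).image (fun u => {v, u}) := by
      intro s hs
      rw [Finset.mem_filter, Finset.mem_powersetCard] at hs
      obtain ⟨⟨hsT, hs2⟩, hcl⟩ := hs
      rw [Finset.mem_union, Finset.mem_filter, Finset.mem_powersetCard]
      by_cases hvs : v ∈ s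
      · right
        obtain ⟨x, y, hxy, rfl⟩ := Finset.card_eq_two.1 hs2
        have hadj : G.Adj x y := hcl (by simp) (by simp) hxy
        rw [Finset.mem_image]
        simp only [Finset.mem_insert, Finset.mem_singleton] at hvs
        rcases hvs with rfl | rfl
        · exact ⟨y, Finset.mem_filter.2 ⟨hsT (by simp), hadj⟩, rfl⟩
        · exact ⟨x, Finset.mem_filter.2 ⟨hsT (by simp), hadj.symm⟩, Finset.pair_comm _ _⟩
      · left
        exact ⟨⟨fun z hz => Finset.mem_erase.2 ⟨by rintro rfl; exact hvs hz, hsT hz⟩, hs2⟩, hcl⟩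
    have h2 := (Finset.card_le_card hsub).trans (Finset.card_union_le _ _)
    have h3 : ((T.filter (G.Adj v)).image (fun u => ({v, u} : Finset V))).card ≤ _ :=
      Finset.card_image_le
    have : (n+1) * k = n * k + k := by ring
    omega

lemma cliqueCount_le [Fintype V] [DecidableRel G.Adj] (k b : ℕ) (hb : (core_s9 G k).card ≤ b)
    (hbn : b ≤ Fintype.card V) :
    cliqueCount G 2 ≤ b.choose 2 + (Fintype.card V - b) * k := by
  classical
  have := edges_bound (G := G) k b hb (Fintype.card V - b) Finset.univ
    (by rw [Finset.card_univ]; omega) (Finset.subset_univ _)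
  refine le_trans (le_of_eq ?_) this
  unfold cliqueCount
  rw [← Set.ncard_coe_finset]
  congr 1
  ext s
  simp [SimpleGraph.isNClique_iff, and_comm]

lemma f_convex (n c k t : ℕ) (hk : 2 ≤ k) (hkt : k ≤ t) (htc : t ≤ c) (hcn : c ≤ n) :
    f 2 n k c ≤ max (f 2 n 2 c) (f 2 n t c) := by
  have key : ∀ j, j ≤ c → ((2 * f 2 n j c : ℕ) : ℤ) =
      ((c:ℤ) - j) * (c - j - 1) + 2 * (n - c + j) * j := by
    intro j hj
    obtain ⟨d, rfl⟩ := Nat.exists_eq_add_of_le hj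
    obtain ⟨e, rfl⟩ := Nat.exists_eq_add_of_le hcn
    have h1 : 2 * (d.choose 2) = d * (d - 1) := by
      rw [Nat.choose_two_right, Nat.mul_div_cancel' (Nat.even_mul_pred_self d).two_dvd]
    have h2 : ((d * (d-1) : ℕ) : ℤ) = d * (d - 1) := by
      cases d <;> simp
    simp only [f, Nat.add_sub_cancel_left, Nat.choose_one_right, show 2 - 1 = 1 from rfl]
    rw [show j + d + e - d = j + e by omega, mul_add, h1]
    push_cast [h2]
    ring_nf
  have e1 := key k (by omega)
  have e2 := key 2 (by omega)
  have e3 := key t htc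
  rw [le_max_iff]
  by_contra hcon
  push Not at hcon
  obtain ⟨a1, a2⟩ := hcon
  have a1' : ((2 * f 2 n 2 c : ℕ) : ℤ) < ((2 * f 2 n k c : ℕ) : ℤ) := by exact_mod_cast (by omega)
  have a2' : ((2 * f 2 n t c : ℕ) : ℤ) < ((2 * f 2 n k c : ℕ) : ℤ) := by exact_mod_cast (by omega)
  rw [e1, e2] at a1'
  rw [e1, e3] at a2'
  zify at hk hkt
  push_cast at a1' a2'
  set L : ℤ := 2 * n - 4 * c + 1 with hL
  have b1 : 0 < ((k:ℤ) - 2) * (3 * (k + 2) + L) := by rw [hL]; nlinarith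
  have b2 : ((t:ℤ) - k) * (3 * (t + k) + L) < 0 := by rw [hL]; nlinarith
  have b3 : 0 < 3 * ((k:ℤ) + 2) + L := by
    by_contra h; push Not at h
    nlinarith
  nlinarith

lemma core_card_le [Fintype V] {c : ℕ} (hc : 5 ≤ c) (hn : c ≤ Fintype.card V) (hno : NoLong G c)
    (hconn : G.Connected) (h2 : ∀ z : V, (G.induce ({z}ᶜ : Set V)).Connected) (H : Finset V)
    (hH : ∀ x ∈ H, ∀ y ∈ H, x ≠ y → G.Adj x y) : H.card ≤ c - 2 := by
  by_contra hcon
  have hr : c - 1 ≤ H.card := by omega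
  obtain ⟨u, hu, v, hv, huv⟩ := Finset.one_lt_card.1 (show 1 < H.card by omega)
  have hlt := hno _ _ _ (PathOn.clique _ H rfl hH u hu v hv huv) (hH u hu v hv huv)
  obtain ⟨w0, hw0⟩ : ∃ w, w ∉ H := by
    by_contra h
    push Not at h
    have : H = Finset.univ := Finset.eq_univ_of_forall h
    rw [this, Finset.card_univ] at hlt
    omega
  -- an edge leaving `H`
  have hedge : ∃ h ∈ H, ∃ w, w ∉ H ∧ G.Adj h w := by
    by_contra hno'
    push Not at hno'
    obtain ⟨q⟩ := hconn.preconnected u w0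
    have : ∀ a b (q : G.Walk a b), a ∈ H → b ∈ H := by
      intro a b q
      induction q with
      | nil => exact id
      | @cons a b c h q ih =>
        intro ha
        refine ih ?_
        by_contra hb
        exact hno' _ ha _ hb h
    exact hw0 (this _ _ q hu)
  obtain ⟨h, hh, w, hw, hhw⟩ := hedge
  have hne : ∃ x ∈ H, x ≠ h := Finset.exists_mem_ne (by omega) h
  obtain ⟨a, ha, h', hh', Q, hQ, hz, hQS, hQT⟩ := PathOn.between (h2 h) {w} {x | x ∈ H ∧ x ≠ h}
    ⟨w, rfl, hhw.ne'⟩ (by obtain ⟨x, hx, hx'⟩ := hne; exact ⟨x, ⟨hx, hx'⟩, hx'⟩)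
  obtain rfl : a = w := ha
  have hP := hQ.join (PathOn.clique _ H rfl hH h' hh'.1 h hh hh'.2) (by
    intro z hz1 hz2
    exact hQT z hz1 ⟨hz2, by rintro rfl; exact hz hz1⟩)
  have hlong := hno _ _ _ hP hhw.symm
  have : (insert a H).card ≤ (Q ∪ H).card := Finset.card_le_card (by
    intro z hz
    rcases Finset.mem_insert.1 hz with rfl | hz
    · exact Finset.mem_union_left _ hQ.left_mem
    · exact Finset.mem_union_right _ hz)
  rw [Finset.card_insert_of_notMem hw] at this
  omega

lemma kopylov_max [Fintype V] (G : SimpleGraph V) (c : ℕ)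
    (hc : 5 ≤ c) (hn : c ≤ Fintype.card V) (hno : NoLong G c)
    (hconn : G.Connected) (h2 : ∀ z : V, (G.induce ({z}ᶜ : Set V)).Connected)
    (hmax : ∀ G' : SimpleGraph V, G ≤ G' → NoLong G' c → G' ≤ G) :
    cliqueCount G 2 ≤
      max (f 2 (Fintype.card V) 2 c) (f 2 (Fintype.card V) ((c - 1) / 2) c) := by
  classical
  obtain ⟨t, ht⟩ : ∃ t, t = (c - 1) / 2 := ⟨_, rfl⟩
  rw [← ht]
  rcases Finset.eq_empty_or_nonempty (core_s9 G t) with hemp | ⟨x0, hx0⟩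
  · refine le_max_of_le_right ?_
    have := cliqueCount_le (G := G) t (c - t) (by simp [hemp]) (by omega)
    simpa [f] using this
  · have hdeg := core_deg (G := G) (k := t)
    have hcl := all_adj (by omega) hno h2 hmax (core_s9 G t) (core_s9 G t) (t+1) (t+1) hdeg hdeg
      (by omega)
    have hr2 := core_card_le hc hn hno hconn h2 _ hcl
    have hfil : ∀ H : Finset V, (∀ x ∈ H, ∀ y ∈ H, x ≠ y → G.Adj x y) → ∀ x ∈ H,
        (H.filter (G.Adj x)).card = H.card - 1 := by
      intro H hH x hx
      rw [← Finset.card_erase_of_mem hx]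
      congr 1
      ext z
      rw [Finset.mem_filter, Finset.mem_erase]
      exact ⟨fun h => ⟨h.2.ne', h.1⟩, fun h => ⟨h.2, hH x hx z h.2 h.1.symm⟩⟩
    have hr1 : t + 2 ≤ (core_s9 G t).card := by
      have h1 := hdeg x0 hx0
      rw [hfil _ hcl x0 hx0] at h1
      omega
    obtain ⟨k, hk⟩ : ∃ k, k = c - (core_s9 G t).card := ⟨_, rfl⟩
    have hcl2 := all_adj (by omega) hno h2 hmax (core_s9 G t) (core_s9 G k) ((core_s9 G t).card - 1) (k+1)
      (fun x hx => (hfil _ hcl x hx).ge) core_deg (by omega)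
    have hsub : core_s9 G k ⊆ core_s9 G t := by
      intro y hy
      by_contra hyt
      refine hyt (subset_core (S := insert y (core_s9 G t)) ?_ (Finset.mem_insert_self _ _))
      intro u hu
      rw [hfil _ _ u hu, Finset.card_insert_of_notMem hyt]
      · omega
      · intro a ha b hb hab
        rcases Finset.mem_insert.1 ha with rfl | ha' <;> rcases Finset.mem_insert.1 hb with rfl | hb'
        · exact absurd rfl hab
        · exact (hcl2 b hb' a hy hab.symm).symm
        · exact hcl2 a ha' b hy hab
        · exact hcl a ha' b hb' hab
    have hb := Finset.card_le_card hsub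
    have := cliqueCount_le (G := G) k (c - k) (by omega) (by omega)
    refine le_trans ?_ (f_convex (Fintype.card V) c k t (by omega) (by omega) (by omega) hn)
    simpa [f] using this

end main

/-- Kopylov's theorem: a 2-connected graph on `n` vertices with circumference less
than `c` (where `n ≥ c ≥ 5`) has at most `max{f_2(n,2,c), f_2(n,⌊(c-1)/2⌋,c)}` edges. -/
theorem kopylov {V : Type*} [Fintype V] (G : SimpleGraph V) (c : ℕ)
    (hc : 5 ≤ c) (hn : c ≤ Fintype.card V) (h2conn : TwoConnected G)
    (hcirc : ∀ (v : V) (w : G.Walk v v), w.IsCycle → w.length < c) :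
    cliqueCount G 2 ≤
      max (f 2 (Fintype.card V) 2 c) (f 2 (Fintype.card V) ((c - 1) / 2) c) := by
  classical
  have hno : NoLong G c := by
    intro u v S hP huv
    by_contra hlt
    obtain ⟨w, hw, hl⟩ := hP.cycle huv (by omega)
    have := hcirc v w hw
    omega
  obtain ⟨G', hle, hG'⟩ := (Set.toFinite {G : SimpleGraph V | NoLong G c}).exists_le_maximal hno
  have h1 := kopylov_max G' c hc hn hG'.prop (h2conn.2.1.mono hle)
    (fun z => (h2conn.2.2 z).mono (by intro a b h; exact hle h))
    (fun G'' h h' => hG'.le_of_ge h' h)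
  refine le_trans ?_ h1
  unfold cliqueCount
  refine Set.ncard_le_ncard ?_ (Set.toFinite _)
  intro s hs
  exact SimpleGraph.IsNClique.mono hle hs
end
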